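/- arXiv:2107.09191 — 8 statements merged into one kernel-verified Lean document; each statement's English description precedes it below -/
import Mathlib

section
/- Let q be an odd prime power and F the finite field with q² elements. Let A be a 2×2 matrix over F and assume the base polynomial F_A is nonsingular. Then the boundary generating curve is contained in the numerical range: Γ_A^∧ ⊆ W(A). -/
open Matrix MvPolynomial

noncomputable section

/-- Conjugate transpose with respect to the Frobenius `x ↦ x ^ q`. -/
def ctrans {F : Type*} [Field F] (q : ℕ) {n : ℕ}
    (A : Matrix (Fin n) (Fin n) F) : Matrix (Fin n) (Fin n) F :=
  Matrix.of fun i j => (A j i) ^ q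

/-- The Hermitian form `⟨u, v⟩ = v* u`. -/
def herm {F : Type*} [Field F] (q : ℕ) {n : ℕ} (u v : Fin n → F) : F :=
  ∑ i, (v i) ^ q * u i

/-- The finite-field numerical range `W(A)`. -/
def numRange {F : Type*} [Field F] (q : ℕ) {n : ℕ}
    (A : Matrix (Fin n) (Fin n) F) : Set F :=
  {z | ∃ v : Fin n → F, herm q v v = 1 ∧ herm q (A.mulVec v) v = z}

/-- `H₁ = (A + A*) / 2`, the Hermitian part of `A`. -/
def Hone {F : Type*} [Field F] (q : ℕ) {n : ℕ}
    (A : Matrix (Fin n) (Fin n) F) : Matrix (Fin n) (Fin n) F :=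
  (2 : F)⁻¹ • (A + ctrans q A)

/-- `H₂ = (A - A*) / (2 β)`. -/
def Htwo {F : Type*} [Field F] (q : ℕ) (β : F) {n : ℕ}
    (A : Matrix (Fin n) (Fin n) F) : Matrix (Fin n) (Fin n) F :=
  (2 * β)⁻¹ • (A - ctrans q A)

/-- The base polynomial `F_A(x, y, t) = det (x H₁ + y H₂ + t I)`,
as a polynomial in the three variables `X 0 = x`, `X 1 = y`, `X 2 = t`. -/
def basePoly {F : Type*} [Field F] (q : ℕ) (β : F) {n : ℕ} [DecidableEq (Fin n)]
    (A : Matrix (Fin n) (Fin n) F) : MvPolynomial (Fin 3) F :=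
  Matrix.det (Matrix.of fun i j =>
    X 0 * C (Hone q A i j) + X 1 * C (Htwo q β A i j) +
      X 2 * C ((1 : Matrix (Fin n) (Fin n) F) i j))

/-- The gradient `∇F_A = (∂F_A/∂x, ∂F_A/∂y, ∂F_A/∂t)` evaluated at a point `p ∈ F³`. -/
def gradBP {F : Type*} [Field F] (q : ℕ) (β : F) {n : ℕ} [DecidableEq (Fin n)]
    (A : Matrix (Fin n) (Fin n) F) (p : Fin 3 → F) : Fin 3 → F :=
  fun i => eval p (pderiv i (basePoly q β A))

/-- `F_A` is nonsingular at a point `p`. -/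
def NonsingAt {F : Type*} [Field F] (q : ℕ) (β : F) {n : ℕ} [DecidableEq (Fin n)]
    (A : Matrix (Fin n) (Fin n) F) (p : Fin 3 → F) : Prop :=
  ¬ (eval p (basePoly q β A) = 0 ∧ gradBP q β A p = 0)

/-- `F_A` is nonsingular (at every nonzero point of `F³`). -/
def Nonsing {F : Type*} [Field F] (q : ℕ) (β : F) {n : ℕ} [DecidableEq (Fin n)]
    (A : Matrix (Fin n) (Fin n) F) : Prop :=
  ∀ p : Fin 3 → F, p ≠ 0 → NonsingAt q β A p

/-- The (affine) boundary generating curve `Γ_A^∧`:  points `x₀ + β y₀` with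
`x₀, y₀ ∈ 𝔽_q` such that the line `x₀ x + y₀ y + t = 0` is tangent to the base curve,
i.e. `∇F_A(p) = c • (x₀, y₀, 1)` for some point `p` of the base curve and `c ≠ 0`. -/
def bgCurve {F : Type*} [Field F] (q : ℕ) (β : F) {n : ℕ} [DecidableEq (Fin n)]
    (A : Matrix (Fin n) (Fin n) F) : Set F :=
  {z | ∃ x₀ y₀ : F, x₀ ^ q = x₀ ∧ y₀ ^ q = y₀ ∧ z = x₀ + β * y₀ ∧
    ∃ p : Fin 3 → F, p ≠ 0 ∧ ∃ c : F, c ≠ 0 ∧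
      eval p (basePoly q β A) = 0 ∧ gradBP q β A p = c • ![x₀, y₀, (1 : F)]}

/-- The preimage `S_z` of `z` under the numerical range map. -/
def preim {F : Type*} [Field F] (q : ℕ) {n : ℕ}
    (A : Matrix (Fin n) (Fin n) F) (z : F) : Set (Fin n → F) :=
  {v | herm q v v = 1 ∧ herm q (A.mulVec v) v = z}

end

/-- In a finite field with `q ^ 2` elements, `q` a power of a prime, `x ↦ x ^ q` is
a ring homomorphism. -/
theorem exists_ringHom_eq_pow {F : Type*} [Field F] [Fintype F] {p k : ℕ} (hp : p.Prime)
    (hcard : Fintype.card F = (p ^ k) ^ 2) : CharP F p ∧ ∃ σ : F →+* F, ∀ x, σ x = x ^ p ^ k := by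
  obtain ⟨r, hr⟩ := CharP.exists F
  obtain ⟨n, hrp, hn⟩ := FiniteField.card F r
  have hrp' : r = p := by
    have h : r ∣ (p ^ k) ^ 2 := by
      rw [← hcard, hn]
      exact dvd_pow_self r n.ne_zero
    exact (Nat.prime_dvd_prime_iff_eq hrp hp).1 (hrp.dvd_of_dvd_pow (hrp.dvd_of_dvd_pow h))
  subst hrp'
  have : Fact r.Prime := ⟨hrp⟩
  exact ⟨hr, iterateFrobenius F r k, fun x => iterateFrobenius_def r k x⟩

/-- The norm map of a quadratic extension of finite fields is surjective. -/
theorem exists_pow_mul_self_eq {F : Type*} [Field F] [Fintype F] {q : ℕ} (hq : 1 < q)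
    (hcard : Fintype.card F = q ^ 2) {u : F} (hu0 : u ≠ 0) (hu : u ^ q = u) :
    ∃ s : F, s ^ q * s = u := by
  obtain ⟨g, hg⟩ := IsCyclic.exists_monoid_generator (α := Fˣ)
  obtain ⟨n, hn⟩ := Submonoid.mem_powers_iff _ _ |>.1 (hg (Units.mk0 u hu0))
  have hord : orderOf g = (q + 1) * (q - 1) := by
    rw [orderOf_eq_card_of_forall_mem_powers hg, Nat.card_units, Nat.card_eq_fintype_card, hcard,
      ← Nat.sq_sub_sq, one_pow]
  have hpow : g ^ (n * (q - 1)) = 1 := by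
    rw [pow_mul, hn]
    ext
    have h : u ^ (q - 1) * u = 1 * u := by
      rw [← pow_succ, Nat.sub_add_cancel hq.le, hu, one_mul]
    simpa using mul_right_cancel₀ hu0 h
  obtain ⟨m, rfl⟩ : q + 1 ∣ n := by
    have h := orderOf_dvd_of_pow_eq_one hpow
    rw [hord] at h
    exact Nat.dvd_of_mul_dvd_mul_right (by omega) h
  refine ⟨(g ^ m : Fˣ), ?_⟩
  rw [← pow_succ, ← Units.val_pow_eq_pow_val, ← pow_mul, mul_comm m, hn, Units.val_mk0]

/-- A singular Hermitian `2 × 2` matrix of trace `1` over a finite field has the form `v v*`. -/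
theorem exists_vec_of_det_eq_zero {F : Type*} [Field F] {σ : F →+* F}
    (hnorm : ∀ u : F, u ≠ 0 → σ u = u → ∃ s, σ s * s = u) {a b c d : F}
    (ha : σ a = a) (hd : σ d = d) (hb : σ b = c) (hc : σ c = b)
    (hdet : a * d = b * c) (htr : a + d = 1) :
    ∃ v w : F, σ v * v = a ∧ v * σ w = b ∧ w * σ v = c ∧ σ w * w = d := by
  by_cases h : a = 0
  · have hd0 : d ≠ 0 := by
      rintro rfl
      simp [h] at htr
    obtain ⟨s, hs⟩ := hnorm d⁻¹ (inv_ne_zero hd0) (by rw [map_inv₀, hd])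
    have hs' : σ s * s * d = 1 := by rw [hs, inv_mul_cancel₀ hd0]
    refine ⟨s * b, s * d, ?_, ?_, ?_, ?_⟩ <;> simp only [map_mul, hd, hb]
    · linear_combination a * hs' - σ s * s * hdet
    · linear_combination b * hs'
    · linear_combination c * hs'
    · linear_combination d * hs'
  · obtain ⟨s, hs⟩ := hnorm a⁻¹ (inv_ne_zero h) (by rw [map_inv₀, ha])
    have hs' : σ s * s * a = 1 := by rw [hs, inv_mul_cancel₀ h]
    refine ⟨s * a, s * c, ?_, ?_, ?_, ?_⟩ <;> simp only [map_mul, ha, hc]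
    · linear_combination a * hs'
    · linear_combination b * hs'
    · linear_combination c * hs'
    · linear_combination d * hs' - σ s * s * hdet

theorem trace_adjugate_mul_fin_two {R : Type*} [CommRing R] (M N : Matrix (Fin 2) (Fin 2) R) :
    (M.adjugate * N).trace = M 1 1 * N 0 0 - M 0 1 * N 1 0 - M 1 0 * N 0 1 + M 0 0 * N 1 1 := by
  rw [trace_fin_two, mul_apply, mul_apply]
  simp only [Fin.sum_univ_two, adjugate_fin_two, of_apply, cons_val', cons_val_zero, cons_val_one,
    cons_val_fin_one]
  ring

theorem trace_adjugate_fin_two {R : Type*} [CommRing R] (M : Matrix (Fin 2) (Fin 2) R) :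
    M.adjugate.trace = M 1 1 + M 0 0 := by
  simp [trace_fin_two, adjugate_fin_two]

section BasePoly

variable {F : Type*} [Field F] (q : ℕ) (β : F) (A : Matrix (Fin 2) (Fin 2) F) (p : Fin 3 → F)

/-- The matrix `x H₁ + y H₂ + t I` at the point `p = (x, y, t)`. -/
def pencil : Matrix (Fin 2) (Fin 2) F :=
  p 0 • Hone q A + p 1 • Htwo q β A + p 2 • 1

theorem eval_basePoly_fin_two : eval p (basePoly q β A) = (pencil q β A p).det := by
  simp [basePoly, pencil, det_fin_two]

/-- Jacobi's formula for the derivative of the determinant of a `2 × 2` matrix. -/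
theorem gradBP_fin_two :
    gradBP q β A p = ![((pencil q β A p).adjugate * Hone q A).trace,
      ((pencil q β A p).adjugate * Htwo q β A).trace, (pencil q β A p).adjugate.trace] := by
  funext i
  fin_cases i <;>
  · simp [gradBP, basePoly, pencil, det_fin_two, trace_adjugate_mul_fin_two,
      trace_adjugate_fin_two, pderiv_X]
    try ring

theorem gradBP_sub (p' : Fin 3 → F) :
    gradBP q β A (p - p') = gradBP q β A p - gradBP q β A p' := by
  simp only [gradBP_fin_two]
  funext i
  fin_cases i <;>
  · simp [pencil, trace_adjugate_mul_fin_two, trace_adjugate_fin_two]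
    ring

theorem gradBP_smul (c : F) : gradBP q β A (c • p) = c • gradBP q β A p := by
  simp only [gradBP_fin_two]
  funext i
  fin_cases i <;>
  · simp [pencil, trace_adjugate_mul_fin_two, trace_adjugate_fin_two]
    ring

theorem eval_basePoly_smul (c : F) :
    eval (c • p) (basePoly q β A) = c ^ 2 * eval p (basePoly q β A) := by
  simp only [eval_basePoly_fin_two]
  simp [pencil, det_fin_two]
  ring

/-- Euler's identity for the quadratic form `F_A`. -/
theorem two_mul_eval_basePoly : 2 * eval p (basePoly q β A) =
    p 0 * gradBP q β A p 0 + p 1 * gradBP q β A p 1 + p 2 * gradBP q β A p 2 := by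
  simp only [eval_basePoly_fin_two, gradBP_fin_two]
  simp [pencil, det_fin_two, trace_adjugate_mul_fin_two, trace_adjugate_fin_two]
  ring

variable {q β A} {σ : F →+* F} (hσ : ∀ x, σ x = x ^ q) (hσσ : ∀ x, σ (σ x) = x)
include hσ hσσ

theorem map_Hone (i j : Fin 2) : σ (Hone q A i j) = Hone q A j i := by
  simp [Hone, ctrans, ← hσ, hσσ, map_ofNat σ 2, add_comm]

theorem map_Htwo (hβ : β ^ q = -β) (i j : Fin 2) : σ (Htwo q β A i j) = Htwo q β A j i := by
  have h : σ β = -β := by rw [hσ, hβ]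
  simp [Htwo, ctrans, ← hσ, hσσ, map_ofNat σ 2, h]
  ring

theorem map_pencil (hβ : β ^ q = -β) (i j : Fin 2) :
    σ (pencil q β A p i j) = pencil q β A (fun k => σ (p k)) j i := by
  have h1 : σ ((1 : Matrix (Fin 2) (Fin 2) F) i j) = (1 : Matrix (Fin 2) (Fin 2) F) j i := by
    fin_cases i <;> fin_cases j <;> simp
  simp [pencil, map_Hone hσ hσσ, map_Htwo hσ hσσ hβ, h1]

theorem map_gradBP (hβ : β ^ q = -β) (i : Fin 3) :
    σ (gradBP q β A p i) = gradBP q β A (fun k => σ (p k)) i := by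
  simp only [gradBP_fin_two]
  fin_cases i <;>
  · simp [trace_adjugate_mul_fin_two, trace_adjugate_fin_two, map_pencil p hσ hσσ hβ,
      map_Hone hσ hσσ, map_Htwo hσ hσσ hβ]
    try ring

end BasePoly

theorem Hone_add_smul_Htwo {F : Type*} [Field F] (q : ℕ) {β : F} (h2 : (2 : F) ≠ 0) (hβ0 : β ≠ 0)
    (A : Matrix (Fin 2) (Fin 2) F) : Hone q A + β • Htwo q β A = A := by
  ext i j
  simp [Hone, Htwo]
  field_simp
  ring

theorem stmt_0 {F : Type*} [Field F] [Fintype F] (q : ℕ)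
    (hq : ∃ p k : ℕ, p.Prime ∧ Odd p ∧ 0 < k ∧ q = p ^ k)
    (hcard : Fintype.card F = q ^ 2)
    (β : F) (hβ0 : β ≠ 0) (hβ : β ^ q = -β)
    (A : Matrix (Fin 2) (Fin 2) F) (hns : Nonsing q β A) :
    bgCurve q β A ⊆ numRange q A := by
  obtain ⟨r, k, hr, hodd, hk, hqr⟩ := hq
  have hq1 : 1 < q := hqr ▸ Nat.one_lt_pow hk.ne' hr.one_lt
  obtain ⟨hchar, σ, hσ⟩ := exists_ringHom_eq_pow (F := F) (k := k) hr (hqr ▸ hcard)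
  rw [← hqr] at hσ
  have h2 : (2 : F) ≠ 0 := Ring.two_ne_zero (by
    rw [ringChar.eq F r]
    rintro rfl
    exact absurd hodd (by decide))
  have hσσ : ∀ x, σ (σ x) = x := fun x => by
    rw [hσ, hσ, ← pow_mul, ← sq, ← hcard, FiniteField.pow_card]
  rintro z ⟨x₀, y₀, hx₀, hy₀, rfl, p, -, c, hc, hp, hgrad⟩
  obtain ⟨P, hP, hgradP⟩ : ∃ P : Fin 3 → F,
      eval P (basePoly q β A) = 0 ∧ gradBP q β A P = ![x₀, y₀, 1] :=
    ⟨c⁻¹ • p, by rw [eval_basePoly_smul, hp, mul_zero],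
      by rw [gradBP_smul, hgrad, inv_smul_smul₀ hc]⟩
  have hfix : (fun i => σ (P i)) = P := by
    by_contra hne
    have hzero : gradBP q β A ((fun i => σ (P i)) - P) = 0 := by
      rw [gradBP_sub, sub_eq_zero]
      funext i
      rw [← map_gradBP P hσ hσσ hβ, hgradP]
      fin_cases i <;> simp [hσ, hx₀, hy₀]
    refine hns _ (sub_ne_zero.2 hne) ⟨mul_left_cancel₀ h2 ?_, hzero⟩
    rw [two_mul_eval_basePoly, hzero]
    simp
  set M := pencil q β A P with hM
  have hherm : ∀ i j, σ (M i j) = M j i := fun i j => by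
    rw [hM, map_pencil P hσ hσσ hβ, hfix]
  rw [eval_basePoly_fin_two, ← hM, det_fin_two] at hP
  rw [gradBP_fin_two, ← hM] at hgradP
  have h₀ := congrFun hgradP 0
  have h₁ := congrFun hgradP 1
  have ht := congrFun hgradP 2
  simp [trace_adjugate_mul_fin_two, trace_adjugate_fin_two] at h₀ h₁ ht
  obtain ⟨v, w, hv, hvw, hwv, hw⟩ := exists_vec_of_det_eq_zero (σ := σ)
    (fun u hu0 hu => by
      simp only [hσ] at hu ⊢
      exact exists_pow_mul_self_eq hq1 hcard hu0 hu)
    (hherm 1 1) (hherm 0 0) (b := -M 0 1) (c := -M 1 0) (by rw [map_neg, hherm])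
    (by rw [map_neg, hherm]) (by linear_combination hP) ht
  refine ⟨![v, w], ?_, ?_⟩
  · simp only [herm, Fin.sum_univ_two, ← hσ]
    simp [hv, hw, ht]
  · have hA := Hone_add_smul_Htwo q h2 hβ0 A
    have hA' : ∀ i j, A i j = Hone q A i j + β * Htwo q β A i j := fun i j => by
      simpa using (congrFun (congrFun hA i) j).symm
    simp only [herm, Fin.sum_univ_two, ← hσ, mulVec, dotProduct, cons_val_zero, cons_val_one]
    calc σ v * (A 0 0 * v + A 0 1 * w) + σ w * (A 1 0 * v + A 1 1 * w)
        = A 0 0 * M 1 1 - A 0 1 * M 1 0 - A 1 0 * M 0 1 + A 1 1 * M 0 0 := by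
          linear_combination A 0 0 * hv + A 0 1 * hwv + A 1 0 * hvw + A 1 1 * hw
      _ = x₀ + β * y₀ := by
          simp only [hA']
          linear_combination h₀ + β * h₁
end

section
/- Let q be an odd prime power and F the finite field with q² elements. Let A be a 2×2 matrix over F, assume the base polynomial F_A is nonsingular, and assume A has an eigenvalue λ ∈ F with a corresponding eigenvector u satisfying ⟨u,u⟩ ≠ 0. Then for every z ∈ W(A): if z ∈ Γ_A^∧ then |S_z| = q + 1, and if z ∉ Γ_A^∧ then |S_z| = 2q + 2. -/
open Matrix MvPolynomial

section Conjugation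

variable {F : Type*} [Field F]

/-- In a finite field with `q²` elements, the map `x ↦ x ^ q` is a ring homomorphism of order `2`. -/
theorem exists_conj_ringHom [Fintype F] {q p k : ℕ} (hp : p.Prime) (hqp : q = p ^ k)
    (hcard : Fintype.card F = q ^ 2) :
    CharP F p ∧ ∃ σ : F →+* F, (∀ x, σ x = x ^ q) ∧ ∀ x, σ (σ x) = x := by
  have : Fact p.Prime := ⟨hp⟩
  have hF : Fintype.card F = p ^ (k * 2) := by rw [hcard, hqp, pow_mul]
  have hc : CharP F p := charP_of_card_eq_prime_pow hF
  have hσ : ∀ x : F, iterateFrobenius F p k x = x ^ q := fun x => by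
    rw [iterateFrobenius_def, hqp]
  refine ⟨hc, iterateFrobenius F p k, hσ, fun x => ?_⟩
  rw [hσ, hσ, ← pow_mul, ← pow_two, ← hcard, FiniteField.pow_card]

theorem ncard_norm_eq [Fintype F] {q : ℕ} (hq : 1 < q) (hcard : Fintype.card F = q ^ 2)
    {s : F} (hs0 : s ≠ 0) (hs : s ^ q = s) :
    {x : F | x ^ q * x = s}.ncard = q + 1 := by
  classical
  have hU : Nat.card Fˣ = (q - 1) * (q + 1) := by
    rw [Nat.card_eq_fintype_card, Fintype.card_units, hcard]
    obtain ⟨r, rfl⟩ : ∃ r, q = r + 1 := ⟨q - 1, by omega⟩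
    simp only [Nat.add_sub_cancel]
    rw [Nat.sub_eq_iff_eq_add (Nat.one_le_pow _ _ (by omega))]
    ring
  have hker : Nat.card (powMonoidHom (q + 1) : Fˣ →* Fˣ).ker = q + 1 := by
    rw [IsCyclic.card_powMonoidHom_ker, hU, Nat.gcd_mul_left_left]
  have hrange : (powMonoidHom (q + 1) : Fˣ →* Fˣ).range = (powMonoidHom (q - 1) : Fˣ →* Fˣ).ker := by
    apply Subgroup.eq_of_le_of_card_ge
    · rintro _ ⟨x, rfl⟩
      rw [MonoidHom.mem_ker, powMonoidHom_apply, powMonoidHom_apply, ← pow_mul, mul_comm, ← hU,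
        pow_card_eq_one']
    · rw [IsCyclic.card_powMonoidHom_ker, IsCyclic.card_powMonoidHom_range, hU,
        Nat.gcd_mul_left_left, Nat.gcd_mul_right_left, Nat.mul_div_cancel _ (by omega)]
  obtain ⟨x, hx⟩ : ∃ x : Fˣ, x ^ (q + 1) = Units.mk0 s hs0 := by
    have : Units.mk0 s hs0 ∈ (powMonoidHom (q + 1) : Fˣ →* Fˣ).range := by
      rw [hrange, MonoidHom.mem_ker, powMonoidHom_apply]
      have h : Units.mk0 s hs0 ^ (q - 1) * Units.mk0 s hs0 = 1 * Units.mk0 s hs0 := by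
        rw [← pow_succ, Nat.sub_add_cancel hq.le]
        ext
        simp [hs]
      exact mul_right_cancel h
    exact this
  have hxs : (x : F) ^ (q + 1) = s := by
    rw [← Units.val_pow_eq_pow_val, hx, Units.val_mk0]
  rw [← hker, ← SetLike.coe_sort_coe, Nat.card_coe_set_eq]
  symm
  apply Set.BijOn.ncard_eq (f := fun k : Fˣ => (x : F) * k)
  refine ⟨fun k hk => ?_, fun a _ b _ hab => ?_, fun y hy => ?_⟩
  · have hk' : k ^ (q + 1) = 1 := hk
    have hk'' : (k : F) ^ (q + 1) = 1 := by
      rw [← Units.val_pow_eq_pow_val, hk', Units.val_one]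
    change ((x : F) * k) ^ q * (x * k) = s
    rw [← pow_succ, mul_pow, hxs, hk'', mul_one]
  · exact Units.ext (mul_left_cancel₀ x.ne_zero hab)
  · have hy' : y ^ (q + 1) = s := by rw [pow_succ]; exact hy
    have hy0 : y ≠ 0 := by
      rintro rfl
      exact hs0 (by rw [← hy', zero_pow (by omega)])
    refine ⟨x⁻¹ * Units.mk0 y hy0, ?_, by simp⟩
    change (x⁻¹ * Units.mk0 y hy0) ^ (q + 1) = 1
    rw [mul_pow, inv_pow, hx]
    ext
    simp [hy', hs0]

end Conjugation

section UnitaryInvariance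

variable {F : Type*} [Field F] {q : ℕ} {σ : F →+* F}

theorem ctrans_eq_transpose_map (hσ : ∀ x, σ x = x ^ q) {n : ℕ} (A : Matrix (Fin n) (Fin n) F) :
    ctrans q A = (A.map σ)ᵀ := by
  ext i j
  simp [ctrans, hσ]

theorem ctrans_mul (hσ : ∀ x, σ x = x ^ q) {n : ℕ} (A B : Matrix (Fin n) (Fin n) F) :
    ctrans q (A * B) = ctrans q B * ctrans q A := by
  simp only [ctrans_eq_transpose_map hσ, Matrix.map_mul, Matrix.transpose_mul]

theorem ctrans_ctrans (hσ : ∀ x, σ x = x ^ q) (hσσ : ∀ x, σ (σ x) = x) {n : ℕ}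
    (A : Matrix (Fin n) (Fin n) F) : ctrans q (ctrans q A) = A := by
  ext i j
  simp [ctrans, ← hσ, hσσ]

theorem herm_mulVec_right (hσ : ∀ x, σ x = x ^ q) {n : ℕ}
    (A : Matrix (Fin n) (Fin n) F) (u v : Fin n → F) :
    herm q u (A *ᵥ v) = herm q (ctrans q A *ᵥ u) v := by
  simp only [herm, ctrans, ← hσ, Matrix.mulVec, dotProduct, map_sum, map_mul, Matrix.of_apply,
    Finset.sum_mul, Finset.mul_sum]
  rw [Finset.sum_comm]
  exact Finset.sum_congr rfl fun i _ => Finset.sum_congr rfl fun j _ => by ring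

theorem basePoly_eq_det (β : F) {n : ℕ} (A : Matrix (Fin n) (Fin n) F) :
    basePoly q β A = Matrix.det ((X 0 : MvPolynomial (Fin 3) F) • (Hone q A).map C +
      (X 1 : MvPolynomial (Fin 3) F) • (Htwo q β A).map C +
      (X 2 : MvPolynomial (Fin 3) F) • (1 : Matrix (Fin n) (Fin n) F).map C) := by
  rfl

variable {n : ℕ} {A U : Matrix (Fin n) (Fin n) F}

theorem basePoly_unitary_conj (hσ : ∀ x, σ x = x ^ q) (hσσ : ∀ x, σ (σ x) = x) (β : F)
    (hU : ctrans q U * U = 1) :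
    basePoly q β (ctrans q U * A * U) = basePoly q β A := by
  have hA : ctrans q (ctrans q U * A * U) = ctrans q U * ctrans q A * U := by
    rw [ctrans_mul hσ, ctrans_mul hσ, ctrans_ctrans hσ hσσ, Matrix.mul_assoc]
  have h1 : Hone q (ctrans q U * A * U) = ctrans q U * Hone q A * U := by
    simp only [Hone, hA, Matrix.mul_smul, Matrix.smul_mul, Matrix.mul_add, Matrix.add_mul]
  have h2 : Htwo q β (ctrans q U * A * U) = ctrans q U * Htwo q β A * U := by
    simp only [Htwo, hA, Matrix.mul_smul, Matrix.smul_mul, Matrix.mul_sub, Matrix.sub_mul]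
  have h3 : (1 : Matrix (Fin n) (Fin n) F) = ctrans q U * 1 * U := by rw [Matrix.mul_one, hU]
  have hdet : ((ctrans q U).map (C : F →+* MvPolynomial (Fin 3) F)).det *
      (U.map (C : F →+* MvPolynomial (Fin 3) F)).det = 1 := by
    rw [← Matrix.det_mul, ← Matrix.map_mul, hU, Matrix.map_one _ (map_zero _) (map_one _),
      Matrix.det_one]
  rw [basePoly_eq_det, basePoly_eq_det, h1, h2]
  nth_rewrite 1 [h3]
  rw [← one_mul (Matrix.det (X 0 • (Hone q A).map C + _ + _)), ← hdet, mul_right_comm,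
    ← Matrix.det_mul, ← Matrix.det_mul]
  simp only [Matrix.map_mul, Matrix.mul_smul, Matrix.smul_mul, Matrix.mul_add, Matrix.add_mul]

theorem bijOn_preim_unitary_conj (hσ : ∀ x, σ x = x ^ q) (hU : ctrans q U * U = 1) (z : F) :
    Set.BijOn (U *ᵥ ·) (preim q (ctrans q U * A * U) z) (preim q A z) := by
  have hU' : U * ctrans q U = 1 := mul_eq_one_comm.mp hU
  have key : ∀ v, U *ᵥ v ∈ preim q A z ↔ v ∈ preim q (ctrans q U * A * U) z := fun v => by
    simp only [preim, Set.mem_ofPred_eq, herm_mulVec_right hσ, Matrix.mulVec_mulVec, hU,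
      Matrix.one_mulVec, Matrix.mul_assoc]
  refine ⟨fun v hv => (key v).2 hv, fun v _ w _ h => ?_, fun w hw => ?_⟩
  · have := congrArg (ctrans q U *ᵥ ·) h
    simpa only [Matrix.mulVec_mulVec, hU, Matrix.one_mulVec] using this
  · have hw' : U *ᵥ (ctrans q U *ᵥ w) = w := by
      rw [Matrix.mulVec_mulVec, hU', Matrix.one_mulVec]
    exact ⟨ctrans q U *ᵥ w, (key _).1 (hw'.symm ▸ hw), hw'⟩

end UnitaryInvariance

section Triangularization

variable {F : Type*} [Field F] {q : ℕ} {σ : F →+* F}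

/-- A `2 × 2` matrix with an anisotropic eigenvector is unitarily triangularizable. -/
theorem exists_unitary_conj_triangular [Fintype F] (hq : 1 < q)
    (hcard : Fintype.card F = q ^ 2) (hσ : ∀ x, σ x = x ^ q) (hσσ : ∀ x, σ (σ x) = x)
    {A : Matrix (Fin 2) (Fin 2) F} {lam : F} {u : Fin 2 → F}
    (hu : A *ᵥ u = lam • u) (huu : herm q u u ≠ 0) :
    ∃ (U : Matrix (Fin 2) (Fin 2) F) (l b m : F),
      ctrans q U * U = 1 ∧ ctrans q U * A * U = !![l, b; 0, m] := by
  have hfix : (herm q u u)⁻¹ ^ q = (herm q u u)⁻¹ := by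
    rw [← hσ, map_inv₀]
    congr 1
    simp only [herm, ← hσ, map_sum, map_mul, hσσ, mul_comm]
  obtain ⟨c, hc⟩ : {x : F | x ^ q * x = (herm q u u)⁻¹}.Nonempty := by
    apply Set.nonempty_of_ncard_ne_zero
    rw [ncard_norm_eq hq hcard (inv_ne_zero huu) hfix]
    omega
  have hc' : σ c * c * herm q u u = 1 := by
    rw [hσ, show c ^ q * c = (herm q u u)⁻¹ from hc, inv_mul_cancel₀ huu]
  have hn : σ c * c * (σ (u 0) * u 0 + σ (u 1) * u 1) = 1 := by
    rw [← hc']; simp [herm, hσ]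
  have hu0 : A 0 0 * u 0 + A 0 1 * u 1 = lam * u 0 := by
    simpa [Matrix.mulVec, dotProduct] using congrFun hu 0
  have hu1 : A 1 0 * u 0 + A 1 1 * u 1 = lam * u 1 := by
    simpa [Matrix.mulVec, dotProduct] using congrFun hu 1
  let U : Matrix (Fin 2) (Fin 2) F := !![c * u 0, -(σ c * σ (u 1)); c * u 1, σ c * σ (u 0)]
  refine ⟨U, (ctrans q U * A * U) 0 0, (ctrans q U * A * U) 0 1, (ctrans q U * A * U) 1 1, ?_, ?_⟩
  · rw [ctrans_eq_transpose_map hσ]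
    ext i j
    fin_cases i <;> fin_cases j <;>
      simp [U, Matrix.mul_apply, hσσ] <;> first | ring1 | linear_combination hn
  · have h10 : (ctrans q U * A * U) 1 0 = 0 := by
      rw [ctrans_eq_transpose_map hσ]
      simp [U, Matrix.mul_apply, hσσ]
      linear_combination (-(c ^ 2 * u 1)) * hu0 + c ^ 2 * u 0 * hu1
    nth_rewrite 1 [Matrix.eta_fin_two (ctrans q U * A * U)]
    rw [h10]

end Triangularization

section Triangular

variable {F : Type*} [Field F]

/-- The Hessian matrix of the base polynomial of `!![l, b; 0, m]` in the coordinates `(ξ, η, t)` with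
`x = ξ + η`, `y = β (ξ - η)`, where `l'`, `m'` are the conjugates of `l`, `m`, and `N` is the norm
of `b`. -/
def triangularGram (l l' m m' N : F) : Matrix (Fin 3) (Fin 3) F :=
  !![2 * l * m, l * m' + l' * m - N, l + m;
     l * m' + l' * m - N, 2 * l' * m', l' + m';
     l + m, l' + m', 2]

theorem det_triangularGram (l l' m m' N : F) :
    (triangularGram l l' m m' N).det = -2 * N * (N + (l - m) * (l' - m')) := by
  rw [triangularGram, Matrix.det_fin_three]
  simp
  ring

variable {q : ℕ} {σ : F →+* F} {β l b m : F}

theorem ctrans_triangular (hσ : ∀ x, σ x = x ^ q) :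
    ctrans q !![l, b; 0, m] = !![σ l, 0; σ b, σ m] := by
  rw [ctrans_eq_transpose_map hσ]
  ext i j
  fin_cases i <;> fin_cases j <;> simp

theorem eval_basePoly_triangular (hσ : ∀ x, σ x = x ^ q) (h2 : (2 : F) ≠ 0) (hβ0 : β ≠ 0)
    {ξ η t : F} :
    eval ![ξ + η, β * (ξ - η), t] (basePoly q β !![l, b; 0, m]) =
      (l * ξ + σ l * η + t) * (m * ξ + σ m * η + t) - b * σ b * ξ * η := by
  simp [basePoly, Matrix.det_fin_two, Hone, Htwo, ctrans_triangular hσ]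
  field_simp
  ring

theorem gradBP_triangular (hσ : ∀ x, σ x = x ^ q) (h2 : (2 : F) ≠ 0) (hβ0 : β ≠ 0)
    {ξ η t : F} :
    gradBP q β !![l, b; 0, m] ![ξ + η, β * (ξ - η), t] =
      let g := triangularGram l (σ l) m (σ m) (b * σ b) *ᵥ ![ξ, η, t]
      ![(g 0 + g 1) / 2, (g 0 - g 1) / (2 * β), g 2] := by
  ext i
  fin_cases i <;>
  · simp [gradBP, basePoly, Matrix.det_fin_two, Hone, Htwo, ctrans_triangular hσ, triangularGram,
      Matrix.mulVec, dotProduct, Fin.sum_univ_three, pderiv_X]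
    field_simp
    ring

theorem exists_eq_isotropic_coords (h2 : (2 : F) ≠ 0) (hβ0 : β ≠ 0) (p : Fin 3 → F) :
    ∃ ξ η t : F, p = ![ξ + η, β * (ξ - η), t] := by
  refine ⟨(p 0 + p 1 / β) / 2, (p 0 - p 1 / β) / 2, p 2, ?_⟩
  ext i
  fin_cases i <;> simp <;> field_simp <;> ring

theorem det_triangularGram_ne_zero (hσ : ∀ x, σ x = x ^ q) (h2 : (2 : F) ≠ 0) (hβ0 : β ≠ 0)
    (hns : Nonsing q β !![l, b; 0, m]) :
    (triangularGram l (σ l) m (σ m) (b * σ b)).det ≠ 0 := by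
  intro hdet
  obtain ⟨v, hv0, hv⟩ := Matrix.exists_mulVec_eq_zero_iff.mpr hdet
  have hv3 : v = ![v 0, v 1, v 2] := by ext i; fin_cases i <;> rfl
  refine hns ![v 0 + v 1, β * (v 0 - v 1), v 2] (fun h => hv0 ?_) ⟨?_, ?_⟩
  · have e0 : v 0 + v 1 = 0 := by simpa using congrFun h 0
    have e1 : v 0 - v 1 = 0 := by simpa [hβ0] using congrFun h 1
    have e2 : v 2 = 0 := by simpa using congrFun h 2
    have h0 : v 0 = 0 := mul_left_cancel₀ h2 (by linear_combination e0 + e1)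
    have h1 : v 1 = 0 := by linear_combination e0 - h0
    rw [hv3, h0, h1, e2]
    ext i; fin_cases i <;> rfl
  · rw [eval_basePoly_triangular hσ h2 hβ0]
    have g0 := congrFun hv 0
    have g1 := congrFun hv 1
    have g2 := congrFun hv 2
    simp [triangularGram, Matrix.mulVec, dotProduct, Fin.sum_univ_three] at g0 g1 g2
    refine mul_left_cancel₀ h2 ?_
    linear_combination v 0 * g0 + v 1 * g1 + v 2 * g2
  · rw [gradBP_triangular hσ h2 hβ0, ← hv3, hv]
    ext i; fin_cases i <;> simp

/-- The equation of the boundary generating curve of `!![l, b; 0, m]`. -/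
theorem mem_bgCurve_triangular_iff (hσ : ∀ x, σ x = x ^ q) (hσσ : ∀ x, σ (σ x) = x)
    (h2 : (2 : F) ≠ 0) (hβ0 : β ≠ 0) (hβ : β ^ q = -β)
    (hns : Nonsing q β !![l, b; 0, m]) (z : F) :
    z ∈ bgCurve q β !![l, b; 0, m] ↔
      (b * σ b + (z - m) * (σ l - σ m) + (σ z - σ m) * (l - m)) ^ 2 =
        4 * (b * σ b + (l - m) * (σ l - σ m)) * ((z - m) * (σ z - σ m)) := by
  have hσβ : σ β = -β := by rw [hσ, hβ]
  have hdet := det_triangularGram_ne_zero hσ h2 hβ0 hns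
  rw [det_triangularGram] at hdet
  constructor
  · rintro ⟨x, y, hx, hy, rfl, p, -, c, hc, hp, hg⟩
    obtain ⟨ξ, η, t, rfl⟩ := exists_eq_isotropic_coords h2 hβ0 p
    rw [eval_basePoly_triangular hσ h2 hβ0] at hp
    rw [gradBP_triangular hσ h2 hβ0] at hg
    have g0 := congrFun hg 0
    have g1 := congrFun hg 1
    have g2 := congrFun hg 2
    simp [triangularGram, Matrix.mulVec, dotProduct, Fin.sum_univ_three] at g0 g1 g2
    rw [div_eq_iff h2] at g0
    rw [div_eq_iff (mul_ne_zero h2 hβ0)] at g1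
    simp only [map_add, map_mul, hσβ, hσ x, hσ y, hx, hy]
    set z := x + β * y with hz
    set z' := x + -β * y with hz'
    have k0 : c * z = 2 * l * m * ξ + (l * σ m + σ l * m - b * σ b) * η + (l + m) * t := by
      refine mul_left_cancel₀ h2 ?_
      linear_combination -g0 - g1
    have k1 : c * z' = (l * σ m + σ l * m - b * σ b) * ξ + 2 * σ l * σ m * η +
        (σ l + σ m) * t := by
      refine mul_left_cancel₀ h2 ?_
      linear_combination -g0 + g1
    have hc2 : c ^ 2 ≠ 0 := pow_ne_zero _ hc
    refine mul_left_cancel₀ hc2 ?_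
    rw [← sub_eq_zero]
    have e : c ^ 2 * (b * σ b + (z - m) * (σ l - σ m) + (z' - σ m) * (l - m)) ^ 2 -
        c ^ 2 * (4 * (b * σ b + (l - m) * (σ l - σ m)) * ((z - m) * (z' - σ m))) =
        (c * (b * σ b) + (c * z - m * c) * (σ l - σ m) + (c * z' - σ m * c) * (l - m)) ^ 2 -
        4 * (b * σ b + (l - m) * (σ l - σ m)) * ((c * z - m * c) * (c * z' - σ m * c)) := by
      ring
    rw [e, k0, k1, ← g2]
    linear_combination 4 * (b * σ b) * (b * σ b + (l - m) * (σ l - σ m)) * hp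
  · intro hz
    have hxy : z = (z + σ z) / 2 + β * ((z - σ z) / (2 * β)) := by field_simp; ring
    have hσ2 : σ 2 = 2 := map_ofNat σ 2
    set N := b * σ b with hN
    set d := l - m with hd
    set d' := σ l - σ m with hd'
    set w := z - m with hw
    set w' := σ z - σ m with hw'
    set ξ := -d' ^ 2 * w + (2 * N + d * d') * w' - N * d' with hξ
    set η := (2 * N + d * d') * w - d ^ 2 * w' - N * d with hη
    set t := -N * d' * w - N * d * w' - N ^ 2 - m * ξ - σ m * η with ht
    have hgrad : gradBP q β !![l, b; 0, m] ![ξ + η, β * (ξ - η), t] =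
        (-2 * N * (N + d * d')) • ![(z + σ z) / 2, (z - σ z) / (2 * β), 1] := by
      rw [gradBP_triangular hσ h2 hβ0]
      ext i
      fin_cases i <;>
      · simp [triangularGram, Matrix.mulVec, dotProduct, Fin.sum_univ_three]
        field_simp
        simp only [ht, hξ, hη, hw, hw', hd, hd', hN]
        ring
    refine ⟨(z + σ z) / 2, (z - σ z) / (2 * β), ?_, ?_, hxy, ![ξ + η, β * (ξ - η), t], ?_,
      -2 * N * (N + d * d'), hdet, ?_, hgrad⟩
    · rw [← hσ, map_div₀, map_add, hσσ, hσ2, add_comm]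
    · rw [← hσ, map_div₀, map_sub, hσσ, map_mul, hσ2, hσβ]
      field_simp
      ring
    · intro h
      have e0 : ξ + η = 0 := by simpa using congrFun h 0
      have e1 : ξ - η = 0 := by simpa [hβ0] using congrFun h 1
      have e2 : t = 0 := by simpa using congrFun h 2
      rw [gradBP_triangular hσ h2 hβ0] at hgrad
      have g2 := congrFun hgrad 2
      have h0 : ξ = 0 := mul_left_cancel₀ h2 (by linear_combination e0 + e1)
      have h1 : η = 0 := by linear_combination e0 - h0
      simp [triangularGram, Matrix.mulVec, dotProduct, Fin.sum_univ_three, h0, h1, e2] at g2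
      exact hdet (by rcases g2 with (h | h) | h <;> simp [h])
    · rw [eval_basePoly_triangular hσ h2 hβ0]
      have hl : l = m + d := by rw [hd]; ring
      have hl' : σ l = σ m + d' := by rw [hd']; ring
      rw [hl', hl, ht]
      simp only [hξ, hη]
      linear_combination N * (N + d * d') * hz

end Triangular

section Counting

variable {F : Type*} [Field F] {q : ℕ} {σ : F →+* F}

/-- The number of vectors with prescribed coordinate norms `s`, `1 - s` and prescribed cross term. -/
theorem ncard_coord_fiber [Fintype F] (hq : 1 < q) (hcard : Fintype.card F = q ^ 2)
    (hσ : ∀ x, σ x = x ^ q) (hσσ : ∀ x, σ (σ x) = x) {b s w : F} (hb : b ≠ 0) (hs : σ s = s)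
    (hw : b * σ b * s * (1 - s) = w * σ w) :
    {v : Fin 2 → F | σ (v 0) * v 0 = s ∧ σ (v 1) * v 1 = 1 - s ∧ b * (σ (v 0) * v 1) = w}.ncard =
      q + 1 := by
  have hσ0 : ∀ {x : F}, σ x = 0 ↔ x = 0 := map_eq_zero σ
  by_cases hs0 : s = 0
  · have hw0 : w = 0 := by
      have : w * σ w = 0 := by rw [← hw, hs0]; ring
      simpa [hσ0] using this
    rw [← ncard_norm_eq hq hcard one_ne_zero (one_pow q)]
    apply Set.BijOn.ncard_eq (f := fun v => v 1)
    refine ⟨?_, ?_, ?_⟩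
    · rintro v ⟨-, h, -⟩
      simpa [hs0, hσ] using h
    · rintro v ⟨h, -, -⟩ v' ⟨h', -, -⟩ hvv
      rw [hs0] at h h'
      simp only [mul_eq_zero, hσ0, or_self] at h h'
      ext i
      fin_cases i
      · simp [h, h']
      · exact hvv
    · intro y hy
      exact ⟨![0, y], by simpa [hs0, hw0] using (hσ y).symm ▸ hy, rfl⟩
  · rw [← ncard_norm_eq hq hcard hs0 (by rw [← hσ, hs])]
    apply Set.BijOn.ncard_eq (f := fun v => v 0)
    refine ⟨?_, ?_, ?_⟩
    · rintro v ⟨h, -, -⟩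
      simpa [hσ] using h
    · rintro v ⟨h, -, h1⟩ v' ⟨-, -, h1'⟩ (hvv : v 0 = v' 0)
      have h0 : b * σ (v 0) ≠ 0 := mul_ne_zero hb fun h' => hs0 (by rw [← h, h', zero_mul])
      ext i
      fin_cases i
      · exact hvv
      · refine mul_left_cancel₀ h0 ?_
        change b * σ (v 0) * v 1 = b * σ (v 0) * v' 1
        rw [mul_assoc, h1, hvv, mul_assoc, h1']
    · intro x hx
      have hx' : σ x * x = s := by rw [hσ]; exact hx
      have hx0 : x ≠ 0 := fun h => hs0 (by rw [← hx', h, mul_zero])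
      have hσx0 : σ x ≠ 0 := mt hσ0.1 hx0
      have hσb0 : σ b ≠ 0 := mt hσ0.1 hb
      refine ⟨![x, w / (b * σ x)], ⟨hx', ?_, ?_⟩, rfl⟩
      · change σ (w / (b * σ x)) * (w / (b * σ x)) = 1 - s
        rw [map_div₀, map_mul, hσσ]
        field_simp
        rw [mul_comm, ← hw, ← hx']
        ring
      · change b * (σ x * (w / (b * σ x))) = w
        field_simp

theorem mem_preim_triangular_iff (hσ : ∀ x, σ x = x ^ q) {l b m z : F} {v : Fin 2 → F} :
    v ∈ preim q !![l, b; 0, m] z ↔ σ (v 1) * v 1 = 1 - σ (v 0) * v 0 ∧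
      b * (σ (v 0) * v 1) = z - m - (l - m) * (σ (v 0) * v 0) := by
  simp only [preim, herm, Set.mem_ofPred_eq, ← hσ, Fin.sum_univ_two, Matrix.mulVec, dotProduct,
    Matrix.of_apply, Matrix.cons_val_zero, Matrix.cons_val_one]
  constructor
  · rintro ⟨h1, h2⟩
    exact ⟨by linear_combination h1, by linear_combination h2 - m * h1⟩
  · rintro ⟨h1, h2⟩
    exact ⟨by linear_combination h1, by linear_combination h2 + m * h1⟩

theorem ncard_preim_triangular [Fintype F] (hq : 1 < q) (hcard : Fintype.card F = q ^ 2)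
    (h2 : (2 : F) ≠ 0) {β : F} (hβ0 : β ≠ 0) (hβ : β ^ q = -β)
    (hσ : ∀ x, σ x = x ^ q) (hσσ : ∀ x, σ (σ x) = x) {l b m z : F}
    (hns : Nonsing q β !![l, b; 0, m]) (hz : (preim q !![l, b; 0, m] z).Nonempty) :
    (z ∈ bgCurve q β !![l, b; 0, m] → (preim q !![l, b; 0, m] z).ncard = q + 1) ∧
    (z ∉ bgCurve q β !![l, b; 0, m] → (preim q !![l, b; 0, m] z).ncard = 2 * q + 2) := by
  have hdet := det_triangularGram_ne_zero hσ h2 hβ0 hns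
  rw [det_triangularGram] at hdet
  have hb : b ≠ 0 := by rintro rfl; simp at hdet
  have ha : b * σ b + (l - m) * (σ l - σ m) ≠ 0 := right_ne_zero_of_mul hdet
  rw [mem_bgCurve_triangular_iff hσ hσσ h2 hβ0 hβ hns]
  set a := b * σ b + (l - m) * (σ l - σ m) with ha_def
  set c := b * σ b + (z - m) * (σ l - σ m) + (σ z - σ m) * (l - m) with hc_def
  set e := (z - m) * (σ z - σ m) with he_def
  have hσa : σ a = a := by simp only [ha_def, map_add, map_mul, map_sub, hσσ]; ring
  have hσc : σ c = c := by simp only [hc_def, map_add, map_mul, map_sub, hσσ]; ring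
  let fiber : F → Set (Fin 2 → F) := fun s => {v | σ (v 0) * v 0 = s ∧ σ (v 1) * v 1 = 1 - s ∧
    b * (σ (v 0) * v 1) = z - m - (l - m) * s}
  have hmem : ∀ v, v ∈ preim q !![l, b; 0, m] z ↔ v ∈ fiber (σ (v 0) * v 0) := fun v => by
    rw [mem_preim_triangular_iff hσ]
    simp [fiber]
  have hsub : ∀ s v, v ∈ fiber s → v ∈ preim q !![l, b; 0, m] z := fun s v hv => by
    rw [hmem, hv.1]
    exact hv
  have hroot : ∀ v ∈ preim q !![l, b; 0, m] z,
      a * (σ (v 0) * v 0) ^ 2 - c * (σ (v 0) * v 0) + e = 0 := fun v hv => by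
    obtain ⟨h1, h2⟩ := (mem_preim_triangular_iff hσ).1 hv
    have h3 := congrArg σ h2
    simp only [map_mul, map_sub, hσσ] at h3
    have h4 : b * σ b * ((σ (v 0) * v 0) * (σ (v 1) * v 1)) =
        (z - m - (l - m) * (σ (v 0) * v 0)) *
          (σ z - σ m - (σ l - σ m) * (v 0 * σ (v 0))) := by
      rw [← h2, ← h3]; ring
    rw [h1] at h4
    simp only [ha_def, hc_def, he_def]
    linear_combination -h4
  have hfiber : ∀ s, σ s = s → a * s ^ 2 - c * s + e = 0 → (fiber s).ncard = q + 1 := by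
    intro s hs hse
    refine ncard_coord_fiber hq hcard hσ hσσ hb hs ?_
    simp only [map_sub, map_mul, hs]
    simp only [ha_def, hc_def, he_def] at hse
    linear_combination -hse
  obtain ⟨v₀, hv₀⟩ := hz
  set s := σ (v₀ 0) * v₀ 0 with hs_def
  have hs : σ s = s := by rw [hs_def, map_mul, hσσ, mul_comm]
  have hse := hroot v₀ hv₀
  rw [← hs_def] at hse
  set s' := c / a - s with hs'_def
  have hc_eq : c = a * (s + s') := by rw [hs'_def]; field_simp; ring
  have he_eq : e = a * (s * s') := by rw [hc_eq] at hse; linear_combination hse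
  have hs' : σ s' = s' := by rw [hs'_def, map_sub, map_div₀, hσa, hσc, hs]
  have hunion : preim q !![l, b; 0, m] z = fiber s ∪ fiber s' := by
    ext v
    refine ⟨fun hv => ?_, fun hv => hv.elim (hsub s v) (hsub s' v)⟩
    have h := hroot v hv
    rw [hc_eq, he_eq] at h
    have h' : a * ((σ (v 0) * v 0 - s) * (σ (v 0) * v 0 - s')) = 0 := by linear_combination h
    rw [mul_eq_zero, or_iff_right ha, mul_eq_zero, sub_eq_zero, sub_eq_zero] at h'
    rw [hmem] at hv
    exact h'.imp (fun hvs => by rwa [hvs] at hv) (fun hvs => by rwa [hvs] at hv)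
  have hdisc : c ^ 2 = 4 * a * e ↔ s = s' := by
    rw [hc_eq, he_eq]
    refine ⟨fun h => ?_, fun h => by rw [h]; ring⟩
    have h' : (a * (s - s')) ^ 2 = 0 := by linear_combination h
    rwa [sq_eq_zero_iff, mul_eq_zero, or_iff_right ha, sub_eq_zero] at h'
  rw [hdisc, hunion]
  refine ⟨fun h => ?_, fun h => ?_⟩
  · rw [← h, Set.union_self, hfiber s hs hse]
  · rw [Set.ncard_union_eq, hfiber s hs hse, hfiber s' hs']
    · ring
    · rw [hc_eq, he_eq]; ring
    · exact Set.disjoint_left.2 fun v hv hv' => h (hv.1.symm.trans hv'.1)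

end Counting

theorem stmt_1 {F : Type*} [Field F] [Fintype F] (q : ℕ)
    (hq : ∃ p k : ℕ, p.Prime ∧ Odd p ∧ 0 < k ∧ q = p ^ k)
    (hcard : Fintype.card F = q ^ 2)
    (β : F) (hβ0 : β ≠ 0) (hβ : β ^ q = -β)
    (A : Matrix (Fin 2) (Fin 2) F) (hns : Nonsing q β A)
    (heig : ∃ (lam : F) (u : Fin 2 → F), u ≠ 0 ∧ A.mulVec u = lam • u ∧ herm q u u ≠ 0) :
    ∀ z ∈ numRange q A,
      (z ∈ bgCurve q β A → (preim q A z).ncard = q + 1) ∧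
      (z ∉ bgCurve q β A → (preim q A z).ncard = 2 * q + 2) := by
  obtain ⟨p, k, hp, hodd, hk, hqp⟩ := hq
  obtain ⟨hchar, σ, hσ, hσσ⟩ := exists_conj_ringHom hp hqp hcard
  have hq1 : 1 < q := hqp ▸ Nat.one_lt_pow hk.ne' hp.one_lt
  have h2 : (2 : F) ≠ 0 := Ring.two_ne_zero (by
    rw [ringChar.eq F p]
    rintro rfl
    exact absurd hodd (by decide))
  obtain ⟨lam, u, -, hu, huu⟩ := heig
  obtain ⟨U, l, b, m, hU, hUA⟩ := exists_unitary_conj_triangular hq1 hcard hσ hσσ hu huu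
  have hpoly := basePoly_unitary_conj (A := A) hσ hσσ β hU
  have hbij := bijOn_preim_unitary_conj (A := A) hσ hU
  rw [hUA] at hpoly hbij
  have hgrad : gradBP q β !![l, b; 0, m] = gradBP q β A := by
    funext p i
    rw [gradBP, hpoly, gradBP]
  have hcurve : bgCurve q β A = bgCurve q β !![l, b; 0, m] := by
    simp only [bgCurve, hpoly, hgrad]
  have hns' : Nonsing q β !![l, b; 0, m] := by
    simpa only [Nonsing, NonsingAt, hgrad, hpoly] using hns
  intro z hz
  have hne : (preim q A z).Nonempty := hz
  rw [← (hbij z).image_eq, Set.image_nonempty] at hne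
  rw [hcurve, ← (hbij z).ncard_eq]
  exact ncard_preim_triangular hq1 hcard h2 hβ0 hβ hσ hσσ hns' hne
end

section
/- Let q be an odd prime power, F the finite field with q² elements, ζ ∈ F, and A = [[1, ζ],[0, 0]]. Set N := ζ^{q+1} ∈ 𝔽_q and assume N ≠ 0 and N ≠ −1. If N(N + 1) is a nonzero square in 𝔽_q, then |W(A)| = (q² + 1)/2; if N(N + 1) is a nonsquare in 𝔽_q, then |W(A)| = (q² − 1)/2. -/
open Matrix MvPolynomial

open scoped Classical in
/-- The elements fixed by `σ`, as a finset. -/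
noncomputable def fixedFinset {F : Type*} [Field F] [Fintype F] (σ : F →+* F) : Finset F :=
  Finset.univ.filter fun x => σ x = x

open scoped Classical in
/-- The squares of the elements fixed by `σ`. -/
noncomputable def fixedSquares {F : Type*} [Field F] [Fintype F] (σ : F →+* F) : Finset F :=
  (fixedFinset σ).image fun t => t ^ 2

section Frobenius

variable {F : Type*} [Field F] [Fintype F]

lemma mem_fixedFinset {σ : F →+* F} {x : F} : x ∈ fixedFinset σ ↔ σ x = x := by
  simp [fixedFinset]

lemma mem_fixedSquares {σ : F →+* F} {x : F} :
    x ∈ fixedSquares σ ↔ ∃ t, σ t = t ∧ t ^ 2 = x := by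
  simp [fixedSquares, mem_fixedFinset]

lemma map_eq_of_mem_fixedSquares {σ : F →+* F} {x : F} (hx : x ∈ fixedSquares σ) : σ x = x := by
  obtain ⟨t, ht, rfl⟩ := mem_fixedSquares.1 hx
  rw [map_pow, ht]

variable {q : ℕ} {σ : F →+* F} (hσ : ∀ x, σ x = x ^ q) (hcard : Fintype.card F = q ^ 2)

include hσ hcard in
lemma frobenius_involutive (x : F) : σ (σ x) = x := by
  rw [hσ, hσ, ← pow_mul, ← sq, ← hcard, FiniteField.pow_card]

include hcard in
lemma one_lt_of_card_eq_sq : 1 < q := by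
  have := Fintype.one_lt_card (α := F)
  rw [hcard] at this
  by_contra h
  interval_cases q <;> simp at this

open scoped Classical in
lemma card_mul_frobenius_eq_le (hσ : ∀ x, σ x = x ^ q) (c : F) :
    (Finset.univ.filter fun w : F => w * σ w = c).card ≤ q + 1 := by
  have h : (Finset.univ.filter fun w : F => w * σ w = c) ⊆
      (Polynomial.nthRoots (q + 1) c).toFinset := by
    intro w hw
    simp only [Finset.mem_filter, Finset.mem_univ, true_and, hσ] at hw
    rw [Multiset.mem_toFinset, Polynomial.mem_nthRoots (Nat.succ_pos q), pow_succ', hw]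
  exact (Finset.card_le_card h).trans
    ((Multiset.toFinset_card_le _).trans (Polynomial.card_nthRoots _ _))

open scoped Classical in
include hσ hcard in
lemma card_fixedFinset_erase_le : ((fixedFinset σ).erase 0).card ≤ q - 1 := by
  have hq := one_lt_of_card_eq_sq hcard
  have h : (fixedFinset σ).erase 0 ⊆ (Polynomial.nthRoots (q - 1) (1 : F)).toFinset := by
    intro w hw
    obtain ⟨h0, h1⟩ := Finset.mem_erase.1 hw
    rw [mem_fixedFinset, hσ] at h1
    rw [Multiset.mem_toFinset, Polynomial.mem_nthRoots (by omega)]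
    apply mul_right_cancel₀ h0
    rw [← pow_succ, Nat.sub_add_cancel hq.le, h1, one_mul]
  exact (Finset.card_le_card h).trans
    ((Multiset.toFinset_card_le _).trans (Polynomial.card_nthRoots _ _))

open scoped Classical in
include hσ hcard in
lemma sum_card_mul_frobenius_eq :
    ∑ c ∈ (fixedFinset σ).erase 0, (Finset.univ.filter fun w : F => w * σ w = c).card =
      (q - 1) * (q + 1) := by
  have hmaps : ∀ w ∈ Finset.univ.erase (0 : F), w * σ w ∈ (fixedFinset σ).erase 0 := by
    intro w hw
    have hw0 : w ≠ 0 := (Finset.mem_erase.1 hw).1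
    rw [Finset.mem_erase, mem_fixedFinset, map_mul, frobenius_involutive hσ hcard]
    exact ⟨mul_ne_zero hw0 (by simpa using hw0), mul_comm _ _⟩
  have h := Finset.card_eq_sum_card_fiberwise hmaps
  rw [Finset.card_erase_of_mem (Finset.mem_univ _), Finset.card_univ, hcard] at h
  have hq := one_lt_of_card_eq_sq hcard
  trans q ^ 2 - 1
  · rw [h]
    refine Finset.sum_congr rfl fun c hc => congrArg Finset.card ?_
    ext w
    simp only [Finset.mem_filter, Finset.mem_univ, true_and, Finset.mem_erase, and_true]
    refine ⟨fun hw => ⟨?_, hw⟩, fun hw => hw.2⟩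
    rintro rfl
    exact (Finset.mem_erase.1 hc).1 (by simpa using hw.symm)
  · obtain ⟨n, rfl⟩ : ∃ n, q = n + 1 := ⟨q - 1, by omega⟩
    rw [Nat.add_sub_cancel]
    apply Nat.sub_eq_of_eq_add
    ring

open scoped Classical in
include hσ hcard in
lemma card_fixedFinset_erase : ((fixedFinset σ).erase 0).card = q - 1 := by
  refine le_antisymm (card_fixedFinset_erase_le hσ hcard) ?_
  have h := Finset.sum_le_sum fun c (_ : c ∈ (fixedFinset σ).erase 0) =>
    card_mul_frobenius_eq_le hσ c
  rw [sum_card_mul_frobenius_eq hσ hcard, Finset.sum_const, smul_eq_mul] at h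
  exact Nat.le_of_mul_le_mul_right h (Nat.succ_pos q)

include hσ hcard in
lemma card_fixedFinset : (fixedFinset σ).card = q := by
  classical
  have h := card_fixedFinset_erase hσ hcard
  have hq := one_lt_of_card_eq_sq hcard
  have h0 : (0 : F) ∈ fixedFinset σ := mem_fixedFinset.2 (map_zero σ)
  rw [Finset.card_erase_of_mem h0] at h
  have := Finset.card_pos.2 ⟨0, h0⟩
  omega

open scoped Classical in
include hσ hcard in
lemma card_mul_frobenius_eq {c : F} (hc : σ c = c) (hc0 : c ≠ 0) :
    (Finset.univ.filter fun w : F => w * σ w = c).card = q + 1 := by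
  have h := (Finset.sum_eq_sum_iff_of_le fun c (_ : c ∈ (fixedFinset σ).erase 0) =>
    card_mul_frobenius_eq_le hσ c).1 (by
      rw [sum_card_mul_frobenius_eq hσ hcard, Finset.sum_const, smul_eq_mul,
        card_fixedFinset_erase hσ hcard])
  exact h c (Finset.mem_erase.2 ⟨hc0, mem_fixedFinset.2 hc⟩)

include hσ hcard in
lemma exists_mul_frobenius_eq {c : F} (hc : σ c = c) : ∃ w, w * σ w = c := by
  classical
  rcases eq_or_ne c 0 with rfl | hc0
  · exact ⟨0, by simp⟩
  · have h := card_mul_frobenius_eq hσ hcard hc hc0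
    obtain ⟨w, hw⟩ := Finset.card_pos.1 (h.ge.trans_lt' (Nat.succ_pos q))
    exact ⟨w, (Finset.mem_filter.1 hw).2⟩

open scoped Classical in
include hσ hcard in
lemma two_mul_card_fixedSquares_erase (h2 : (2 : F) ≠ 0) :
    2 * ((fixedSquares σ).erase 0).card = q - 1 := by
  have hmaps : ∀ t ∈ (fixedFinset σ).erase 0, t ^ 2 ∈ (fixedSquares σ).erase 0 := by
    intro t ht
    obtain ⟨h0, h1⟩ := Finset.mem_erase.1 ht
    exact Finset.mem_erase.2 ⟨pow_ne_zero 2 h0,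
      mem_fixedSquares.2 ⟨t, mem_fixedFinset.1 h1, rfl⟩⟩
  rw [← card_fixedFinset_erase hσ hcard, Finset.card_eq_sum_card_fiberwise hmaps,
    Finset.sum_const_nat (m := 2), mul_comm]
  intro s hs
  obtain ⟨hs0, hs1⟩ := Finset.mem_erase.1 hs
  obtain ⟨t, ht, rfl⟩ := mem_fixedSquares.1 hs1
  have ht0 : t ≠ 0 := by rintro rfl; simp at hs0
  have hne : t ≠ -t := by
    intro h
    have : 2 * t = 0 := by linear_combination h
    simp [h2, ht0] at this
  refine (congrArg Finset.card ?_).trans (Finset.card_pair hne)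
  ext x
  simp only [Finset.mem_filter, Finset.mem_erase, mem_fixedFinset, Finset.mem_insert,
    Finset.mem_singleton, sq_eq_sq_iff_eq_or_eq_neg]
  refine ⟨fun h => h.2, ?_⟩
  rintro (rfl | rfl) <;> simp [ht0, ht]

include hσ hcard in
lemma two_mul_card_fixedSquares (h2 : (2 : F) ≠ 0) :
    2 * (fixedSquares σ).card = q + 1 := by
  classical
  have h := two_mul_card_fixedSquares_erase hσ hcard h2
  have hq := one_lt_of_card_eq_sq hcard
  have h0 : (0 : F) ∈ fixedSquares σ := mem_fixedSquares.2 ⟨0, map_zero σ, by simp⟩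
  rw [Finset.card_erase_of_mem h0] at h
  have := Finset.card_pos.2 ⟨0, h0⟩
  omega

open scoped Classical in
include hσ hcard in
/-- The count for the anisotropic form `w ↦ w * σ w`. -/
lemma two_mul_card_sub_mul_frobenius (h2 : (2 : F) ≠ 0) {r N : F} (hr : σ r = r)
    (hN : σ N = N) (hN0 : N ≠ 0) :
    2 * (Finset.univ.filter fun w : F => r ^ 2 - N * (w * σ w) ∈ fixedSquares σ).card =
      q ^ 2 + 1 := by
  have hmem : r ^ 2 ∈ fixedSquares σ := mem_fixedSquares.2 ⟨r, hr, rfl⟩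
  have hfib : ∀ s ∈ fixedSquares σ,
      ((Finset.univ.filter fun w : F => r ^ 2 - N * (w * σ w) ∈ fixedSquares σ).filter
        fun w => r ^ 2 - N * (w * σ w) = s) =
      Finset.univ.filter fun w : F => w * σ w = (r ^ 2 - s) / N := by
    intro s hs
    ext w
    simp only [Finset.mem_filter, Finset.mem_univ, true_and, eq_div_iff hN0]
    refine ⟨fun h => by linear_combination -h.2, fun h => ?_⟩
    have : r ^ 2 - N * (w * σ w) = s := by linear_combination -h
    exact ⟨this ▸ hs, this⟩
  have hmaps : ∀ x ∈ (Finset.univ.filter fun w : F => r ^ 2 - N * (w * σ w) ∈ fixedSquares σ),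
      (fun w => r ^ 2 - N * (w * σ w)) x ∈ fixedSquares σ := fun x hx => (Finset.mem_filter.1 hx).2
  rw [Finset.card_eq_sum_card_fiberwise hmaps,
    Finset.sum_congr rfl fun s hs => congrArg Finset.card (hfib s hs),
    ← Finset.add_sum_erase _ _ hmem, Finset.sum_const_nat (m := q + 1)]
  · have h0 : (Finset.univ.filter fun w : F => w * σ w = (r ^ 2 - r ^ 2) / N) = {0} := by
      ext w
      simp
    have hS := two_mul_card_fixedSquares hσ hcard h2
    have hq := one_lt_of_card_eq_sq hcard
    rw [h0, Finset.card_singleton, Finset.card_erase_of_mem hmem]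
    obtain ⟨n, hn⟩ : ∃ n, (fixedSquares σ).card = n + 1 := ⟨(fixedSquares σ).card - 1, by omega⟩
    obtain rfl : q = 2 * n + 1 := by omega
    rw [hn, Nat.add_sub_cancel]
    ring
  · intro s hs
    obtain ⟨hne, hs⟩ := Finset.mem_erase.1 hs
    refine card_mul_frobenius_eq hσ hcard ?_ (div_ne_zero (sub_ne_zero.2 hne.symm) hN0)
    rw [map_div₀, map_sub, map_pow, hr, hN, map_eq_of_mem_fixedSquares hs]

open scoped Classical in
include hσ hcard in
lemma card_fixed_mul_eq {c : F} (hc : σ c = c) (hc0 : c ≠ 0) :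
    ((fixedFinset σ ×ˢ fixedFinset σ).filter fun p => p.1 * p.2 = c).card = q - 1 := by
  rw [← card_fixedFinset_erase hσ hcard]
  symm
  refine Finset.card_bij (fun a _ => (a, c / a)) ?_ (fun a _ b _ h => (Prod.ext_iff.1 h).1) ?_
  · intro a ha
    obtain ⟨h0, h1⟩ := Finset.mem_erase.1 ha
    rw [mem_fixedFinset] at h1
    simp only [Finset.mem_filter, Finset.mem_product, mem_fixedFinset, map_div₀, hc, h1, true_and]
    exact mul_div_cancel₀ c h0
  · rintro ⟨a, b⟩ h
    simp only [Finset.mem_filter, Finset.mem_product, mem_fixedFinset] at h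
    obtain ⟨⟨ha, hb⟩, hab⟩ := h
    have ha0 : a ≠ 0 := by rintro rfl; exact hc0 (by simpa using hab.symm)
    exact ⟨a, Finset.mem_erase.2 ⟨ha0, mem_fixedFinset.2 ha⟩,
      Prod.ext rfl (by rw [← hab]; exact mul_div_cancel_left₀ b ha0)⟩

open scoped Classical in
include hσ hcard in
/-- The count for the split form `(a, b) ↦ a * b`. -/
lemma two_mul_card_sub_mul (h2 : (2 : F) ≠ 0) {M N : F} (hM : σ M = M)
    (hMsq : M ∉ fixedSquares σ) (hN : σ N = N) (hN0 : N ≠ 0) :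
    2 * ((fixedFinset σ ×ˢ fixedFinset σ).filter
      fun p => M - N * (p.1 * p.2) ∈ fixedSquares σ).card = q ^ 2 - 1 := by
  have hfib : ∀ s ∈ fixedSquares σ,
      (((fixedFinset σ ×ˢ fixedFinset σ).filter
        fun p => M - N * (p.1 * p.2) ∈ fixedSquares σ).filter
        fun p => M - N * (p.1 * p.2) = s) =
      (fixedFinset σ ×ˢ fixedFinset σ).filter fun p => p.1 * p.2 = (M - s) / N := by
    intro s hs
    ext p
    simp only [Finset.mem_filter, eq_div_iff hN0, and_assoc]
    refine and_congr_right fun _ => ⟨fun h => by linear_combination -h.2, fun h => ?_⟩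
    have : M - N * (p.1 * p.2) = s := by linear_combination -h
    exact ⟨this ▸ hs, this⟩
  have hmaps : ∀ x ∈ ((fixedFinset σ ×ˢ fixedFinset σ).filter
      fun p => M - N * (p.1 * p.2) ∈ fixedSquares σ),
      (fun p => M - N * (p.1 * p.2)) x ∈ fixedSquares σ := fun x hx => (Finset.mem_filter.1 hx).2
  rw [Finset.card_eq_sum_card_fiberwise hmaps,
    Finset.sum_congr rfl fun s hs => congrArg Finset.card (hfib s hs),
    Finset.sum_const_nat (m := q - 1), ← mul_assoc, two_mul_card_fixedSquares hσ hcard h2]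
  · simpa using (Nat.sq_sub_sq q 1).symm
  · intro s hs
    refine card_fixed_mul_eq hσ hcard ?_ (div_ne_zero (sub_ne_zero.2 ?_) hN0)
    · rw [map_div₀, map_sub, hM, hN, map_eq_of_mem_fixedSquares hs]
    · rintro rfl
      exact hMsq hs

include hσ hcard in
/-- Membership in the numerical range, as solvability of a quadratic equation over the
fixed field. -/
lemma mem_numRange_iff_exists (ζ z : F) :
    z ∈ numRange q !![1, ζ; 0, 0] ↔
      ∃ s, σ s = s ∧ (z - s) * (σ z - s) = ζ * σ ζ * (s * (1 - s)) := by
  simp only [numRange, herm, Set.mem_ofPred_eq, ← hσ, Fin.sum_univ_two, Matrix.mulVec,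
    dotProduct, Matrix.of_apply, Matrix.cons_val', Matrix.cons_val_zero, Matrix.cons_val_one,
    Matrix.cons_val_fin_one, one_mul, zero_mul, mul_zero, add_zero]
  have inv := frobenius_involutive hσ hcard
  constructor
  · rintro ⟨v, h1, rfl⟩
    refine ⟨σ (v 0) * v 0, by rw [map_mul, inv, mul_comm], ?_⟩
    simp only [map_mul, map_add, inv]
    linear_combination (ζ * σ ζ * σ (v 0) * v 0) * h1
  · rintro ⟨s, hs, h⟩
    rcases eq_or_ne s 0 with rfl | hs0
    · have hz : z = 0 := by simpa using h
      refine ⟨![0, 1], by simp, by simp [hz]⟩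
    obtain ⟨a, ha⟩ := exists_mul_frobenius_eq hσ hcard hs
    have ha0 : a ≠ 0 := by rintro rfl; simp at ha; exact hs0 ha.symm
    have hσa : σ a ≠ 0 := by simpa using ha0
    by_cases hζ : ζ = 0
    · have hs1 : σ (1 - s) = 1 - s := by rw [map_sub, map_one, hs]
      obtain ⟨b, hb⟩ := exists_mul_frobenius_eq hσ hcard hs1
      refine ⟨![a, b], by simp; linear_combination ha + hb, ?_⟩
      have hz : z = s := by
        have h' : (z - s) * σ (z - s) = 0 := by rw [map_sub, hs, h, hζ]; simp
        have : z - s = 0 := (mul_eq_zero.1 h').elim id (map_eq_zero σ).1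
        linear_combination this
      simp [hζ, hz]
      linear_combination ha
    have hσζ : σ ζ ≠ 0 := by simpa using hζ
    refine ⟨![a, (z - s) / (ζ * σ a)], ?_, ?_⟩
    · simp only [Matrix.cons_val_zero, Matrix.cons_val_one, map_div₀, map_sub, map_mul, inv, hs]
      field_simp
      apply mul_left_cancel₀ hs0
      linear_combination s * (σ ζ * ζ * (a * σ a - 1 + s)) * ha + s * h
    · simp only [Matrix.cons_val_zero, Matrix.cons_val_one]
      field_simp
      linear_combination ha

include hσ hcard in
/-- Membership in the numerical range, via the discriminant. -/
lemma mem_numRange_iff (h2 : (2 : F) ≠ 0) {ζ N : F} (hN : N = ζ * σ ζ) (hN1 : N + 1 ≠ 0) (z : F) :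
    z ∈ numRange q !![1, ζ; 0, 0] ↔
      N * (N + 1) - N * (z + σ z - 1) ^ 2 + (N + 1) * (z - σ z) ^ 2 ∈ fixedSquares σ := by
  rw [mem_numRange_iff_exists hσ hcard, mem_fixedSquares, ← hN]
  have inv := frobenius_involutive hσ hcard
  have hNσ : σ N = N := by rw [hN, map_mul, inv, mul_comm]
  constructor
  · rintro ⟨s, hs, h⟩
    refine ⟨2 * (N + 1) * s - (z + σ z + N), ?_, by linear_combination 4 * (N + 1) * h⟩
    simp only [map_sub, map_mul, map_add, map_one, map_ofNat, hNσ, hs, inv]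
    ring
  · rintro ⟨t, ht, h⟩
    refine ⟨(t + (z + σ z + N)) / (2 * (N + 1)), ?_, ?_⟩
    · simp only [map_div₀, map_mul, map_add, map_one, map_ofNat, hNσ, ht, inv]
      ring
    · field_simp
      linear_combination (N + 1) * h

include hσ hcard in
lemma two_mul_ncard_numRange_of_square (h2 : (2 : F) ≠ 0) {ζ N r : F} (hN : N = ζ * σ ζ)
    (hN0 : N ≠ 0) (hN1 : N + 1 ≠ 0) (hr : σ r = r) (hrM : r ^ 2 = N * (N + 1)) :
    2 * (numRange q !![1, ζ; 0, 0]).ncard = q ^ 2 + 1 := by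
  classical
  have inv := frobenius_involutive hσ hcard
  have hNσ : σ N = N := by rw [hN, map_mul, inv, mul_comm]
  have hr0 : r ≠ 0 := by
    rintro rfl
    exact mul_ne_zero hN0 hN1 (by simpa using hrM.symm)
  let φ : F → F := fun z => (z + σ z - 1) + r / N * (z - σ z)
  have hφσ : ∀ z, σ (φ z) = (z + σ z - 1) - r / N * (z - σ z) := by
    intro z
    simp only [φ, map_sub, map_mul, map_add, map_one, map_div₀, hNσ, hr, inv]
    ring
  have hinj : Function.Injective φ := by
    intro z w h
    have h' := congrArg σ h
    rw [hφσ, hφσ] at h'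
    simp only [φ] at h
    have e : r * (2 * (z - w - (σ z - σ w))) = 0 := by
      field_simp at h h'
      linear_combination h - h'
    have e' : z - w - (σ z - σ w) = 0 := by simpa [hr0, h2] using e
    apply mul_left_cancel₀ h2
    apply mul_left_cancel₀ h2
    linear_combination h + h' + 2 * e'
  have hbij : Function.Bijective φ := Finite.injective_iff_bijective.1 hinj
  rw [← two_mul_card_sub_mul_frobenius hσ hcard h2 hr hNσ hN0, ← Set.ncard_coe_finset]
  congr 1
  refine Set.ncard_congr (fun z _ => φ z) ?_ (fun z w _ _ h => hinj h) ?_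
  all_goals
    have key : ∀ z, z ∈ numRange q !![1, ζ; 0, 0] ↔
        r ^ 2 - N * (φ z * σ (φ z)) ∈ fixedSquares σ := by
      intro z
      rw [mem_numRange_iff hσ hcard h2 hN hN1]
      suffices h : N * (N + 1) - N * (z + σ z - 1) ^ 2 + (N + 1) * (z - σ z) ^ 2 =
        r ^ 2 - N * (φ z * σ (φ z)) by rw [h]
      rw [hφσ]
      simp only [φ]
      field_simp
      linear_combination (-N - (z - σ z) ^ 2) * hrM
  · intro z hz
    simpa using (key z).1 hz
  · intro w hw
    obtain ⟨z, rfl⟩ := hbij.2 w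
    exact ⟨z, (key z).2 (by simpa using hw), rfl⟩

include hσ hcard in
/-- A fixed element that is not the square of a fixed element is the square of an element
negated by `σ`. -/
lemma exists_sq_eq_of_notMem_fixedSquares (hq : Odd q) {M : F} (hM : σ M = M)
    (hMsq : M ∉ fixedSquares σ) : ∃ r, σ r = -r ∧ r ^ 2 = M := by
  obtain ⟨w, hw⟩ := exists_mul_frobenius_eq hσ hcard hM
  obtain ⟨n, hn⟩ := hq
  have hr : (w ^ (n + 1)) ^ 2 = M := by
    rw [← hw, hσ, ← pow_mul, ← pow_succ', hn]
    congr 1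
    ring
  refine ⟨w ^ (n + 1), ?_, hr⟩
  have h : σ (w ^ (n + 1)) ^ 2 = (w ^ (n + 1)) ^ 2 := by
    rw [← map_pow, hr, hM]
  refine (sq_eq_sq_iff_eq_or_eq_neg.1 h).resolve_left fun h' => ?_
  exact hMsq (mem_fixedSquares.2 ⟨_, h', hr⟩)

include hσ hcard in
lemma two_mul_ncard_numRange_of_nonsquare (hq : Odd q) (h2 : (2 : F) ≠ 0) {ζ N : F}
    (hN : N = ζ * σ ζ) (hN0 : N ≠ 0) (hN1 : N + 1 ≠ 0)
    (hM : N * (N + 1) ∉ fixedSquares σ) :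
    2 * (numRange q !![1, ζ; 0, 0]).ncard = q ^ 2 - 1 := by
  classical
  have inv := frobenius_involutive hσ hcard
  have hNσ : σ N = N := by rw [hN, map_mul, inv, mul_comm]
  have hMσ : σ (N * (N + 1)) = N * (N + 1) := by simp [hNσ]
  obtain ⟨r, hr, hrM⟩ := exists_sq_eq_of_notMem_fixedSquares hσ hcard hq hMσ hM
  have hr0 : r ≠ 0 := by
    rintro rfl
    exact mul_ne_zero hN0 hN1 (by simpa using hrM.symm)
  let φ : F → F × F := fun z =>
    ((z + σ z - 1) + r / N * (z - σ z), (z + σ z - 1) - r / N * (z - σ z))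
  have hφmem : ∀ z ∈ Finset.univ, φ z ∈ fixedFinset σ ×ˢ fixedFinset σ := by
    intro z _
    simp only [φ, Finset.mem_product, mem_fixedFinset, map_sub, map_mul, map_add, map_one,
      map_div₀, hNσ, hr, inv]
    constructor <;> ring
  have hinj : Function.Injective φ := by
    intro z w h
    obtain ⟨h, h'⟩ := Prod.ext_iff.1 h
    simp only [φ] at h h'
    have e : r * (2 * (z - w - (σ z - σ w))) = 0 := by
      field_simp at h h'
      linear_combination h - h'
    have e' : z - w - (σ z - σ w) = 0 := by simpa [hr0, h2] using e
    apply mul_left_cancel₀ h2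
    apply mul_left_cancel₀ h2
    linear_combination h + h' + 2 * e'
  have hsurj := Finset.surj_on_of_inj_on_of_card_le (fun z _ => φ z) hφmem
    (fun z w _ _ h => hinj h) (by
      rw [Finset.card_product, card_fixedFinset hσ hcard, Finset.card_univ, hcard, sq])
  rw [← two_mul_card_sub_mul hσ hcard h2 hMσ hM hNσ hN0, ← Set.ncard_coe_finset]
  congr 1
  have key : ∀ z, z ∈ numRange q !![1, ζ; 0, 0] ↔
      N * (N + 1) - N * ((φ z).1 * (φ z).2) ∈ fixedSquares σ := by
    intro z
    rw [mem_numRange_iff hσ hcard h2 hN hN1]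
    suffices h : N * (N + 1) - N * (z + σ z - 1) ^ 2 + (N + 1) * (z - σ z) ^ 2 =
      N * (N + 1) - N * ((φ z).1 * (φ z).2) by rw [h]
    simp only [φ]
    field_simp
    linear_combination (-(z - σ z) ^ 2) * hrM
  refine Set.ncard_congr (fun z _ => φ z) ?_ (fun z w _ _ h => hinj h) ?_
  · intro z hz
    exact Finset.mem_coe.2 (Finset.mem_filter.2 ⟨hφmem z (Finset.mem_univ z), (key z).1 hz⟩)
  · intro w hw
    obtain ⟨hw1, hw2⟩ := Finset.mem_filter.1 (Finset.mem_coe.1 hw)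
    obtain ⟨z, _, rfl⟩ := hsurj w hw1
    exact ⟨z, (key z).2 hw2, rfl⟩

end Frobenius

theorem stmt_3 {F : Type*} [Field F] [Fintype F] (q : ℕ)
    (hq : ∃ p k : ℕ, p.Prime ∧ Odd p ∧ 0 < k ∧ q = p ^ k)
    (hcard : Fintype.card F = q ^ 2)
    (β : F) (hβ0 : β ≠ 0) (hβ : β ^ q = -β)
    (ζ : F) (hN0 : ζ ^ (q + 1) ≠ 0) (hN1 : ζ ^ (q + 1) ≠ -1) :
    ((∃ s : F, s ^ q = s ∧ s ≠ 0 ∧ s ^ 2 = ζ ^ (q + 1) * (ζ ^ (q + 1) + 1)) →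
      (numRange q (!![1, ζ; 0, 0])).ncard = (q ^ 2 + 1) / 2) ∧
    ((¬ ∃ s : F, s ^ q = s ∧ s ^ 2 = ζ ^ (q + 1) * (ζ ^ (q + 1) + 1)) →
      (numRange q (!![1, ζ; 0, 0])).ncard = (q ^ 2 - 1) / 2) := by
  obtain ⟨p, k, hp, hpodd, hk, rfl⟩ := hq
  have hpF : (p : F) = 0 := by
    have h := Nat.cast_card_eq_zero F
    rw [hcard] at h
    push_cast at h
    exact eq_zero_of_pow_eq_zero (eq_zero_of_pow_eq_zero h)
  have : Fact p.Prime := ⟨hp⟩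
  have : CharP F p := (CharP.charP_iff_prime_eq_zero hp).2 hpF
  have hqodd : Odd (p ^ k) := hpodd.pow
  have h2 : (2 : F) ≠ 0 := by
    apply Ring.two_ne_zero
    rw [ringChar.eq F p]
    rintro rfl
    exact absurd hpodd (by decide)
  have hσ : ∀ x : F, iterateFrobenius F p k x = x ^ p ^ k := fun x => iterateFrobenius_def p k x
  have hN : ζ ^ (p ^ k + 1) = ζ * iterateFrobenius F p k ζ := by rw [hσ, pow_succ']
  have hN1' : ζ ^ (p ^ k + 1) + 1 ≠ 0 := fun h => hN1 (eq_neg_of_add_eq_zero_left h)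
  constructor
  · rintro ⟨s, hs, -, hsM⟩
    have := two_mul_ncard_numRange_of_square hσ hcard h2 hN hN0 hN1' (by rw [hσ, hs]) hsM
    omega
  · intro h
    have := two_mul_ncard_numRange_of_nonsquare hσ hcard hqodd h2 hN hN0 hN1' (by
      rw [mem_fixedSquares]
      rintro ⟨t, ht, htM⟩
      exact h ⟨t, by rw [← hσ, ht], htM⟩)
    omega
end

section
/- Let q be an odd prime power, F the finite field with q² elements, ζ ∈ F, and A = [[1, ζ],[0, 0]]. Set N := ζ^{q+1} ∈ 𝔽_q and assume N ≠ 0 and N ≠ −1. Then the boundary generating curve of A is the conic Γ_A^∧ = { x + β·y : x, y ∈ 𝔽_q and (x − 2⁻¹)²/(1 + N) − α·y²/N = 4⁻¹ }. -/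
open Matrix MvPolynomial

theorem two_ne_zero_of_odd_card {F : Type*} [Field F] [Fintype F]
    (h : Odd (Fintype.card F)) : (2 : F) ≠ 0 := by
  refine Ring.two_ne_zero fun hchar => ?_
  have := FiniteField.even_card_iff_char_two.mp hchar
  have := Nat.odd_iff.mp h
  omega

theorem ctrans_upper {F : Type*} [Field F] {q : ℕ} (hq : q ≠ 0) (ζ : F) :
    ctrans q !![1, ζ; 0, 0] = !![1, 0; ζ ^ q, 0] := by
  ext i j
  fin_cases i <;> fin_cases j <;> simp [ctrans, hq]

/-- The base polynomial of `[[1, ζ], [0, 0]]`. -/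
theorem basePoly_upper {F : Type*} [Field F] {q : ℕ} (hq : q ≠ 0) (β ζ : F) :
    basePoly q β !![1, ζ; 0, 0] =
      (X 0 * C ((2 : F)⁻¹ * (1 + 1)) + X 2) * X 2 -
        (X 0 * C (2⁻¹ * ζ) + X 1 * C ((2 * β)⁻¹ * ζ)) *
          (X 0 * C (2⁻¹ * ζ ^ q) - X 1 * C ((2 * β)⁻¹ * ζ ^ q)) := by
  simp [basePoly, Hone, Htwo, ctrans_upper hq, Matrix.det_fin_two]
  exact Or.inl (by ring)

theorem eval_basePoly_upper {F : Type*} [Field F] {q : ℕ} (hq : q ≠ 0) (h2 : (2 : F) ≠ 0)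
    {β : F} (hβ : β ≠ 0) (ζ : F) (p : Fin 3 → F) :
    eval p (basePoly q β !![1, ζ; 0, 0]) =
      p 2 ^ 2 + p 0 * p 2 - ζ ^ (q + 1) * (p 0 ^ 2 / 4 - p 1 ^ 2 / (4 * β ^ 2)) := by
  have h4 : (4 : F) ≠ 0 := by simpa [show (4 : F) = 2 * 2 by norm_num] using h2
  rw [basePoly_upper hq]
  simp only [map_sub, map_add, map_mul, eval_X, eval_C]
  field_simp
  ring

theorem gradBP_upper {F : Type*} [Field F] {q : ℕ} (hq : q ≠ 0) (h2 : (2 : F) ≠ 0)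
    {β : F} (hβ : β ≠ 0) (ζ : F) (p : Fin 3 → F) :
    gradBP q β !![1, ζ; 0, 0] p =
      ![p 2 - ζ ^ (q + 1) * p 0 / 2, ζ ^ (q + 1) * p 1 / (2 * β ^ 2), 2 * p 2 + p 0] := by
  funext i
  fin_cases i <;>
  · simp [gradBP, basePoly_upper hq, Derivation.leibniz, pderiv_X]
    field_simp
    ring

theorem stmt_4 {F : Type*} [Field F] [Fintype F] (q : ℕ)
    (hq : ∃ p k : ℕ, p.Prime ∧ Odd p ∧ 0 < k ∧ q = p ^ k)
    (hcard : Fintype.card F = q ^ 2)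
    (β : F) (hβ0 : β ≠ 0) (hβ : β ^ q = -β)
    (ζ : F) (hN0 : ζ ^ (q + 1) ≠ 0) (hN1 : ζ ^ (q + 1) ≠ -1) :
    bgCurve q β (!![1, ζ; 0, 0]) =
      {z : F | ∃ x y : F, x ^ q = x ∧ y ^ q = y ∧ z = x + β * y ∧
        (x - 2⁻¹) ^ 2 / (1 + ζ ^ (q + 1)) - β ^ 2 * y ^ 2 / ζ ^ (q + 1) = 4⁻¹} := by
  have hq0 : q ≠ 0 := by
    rintro rfl
    simp at hcard
  have h2 : (2 : F) ≠ 0 := by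
    obtain ⟨p, k, -, hp, -, rfl⟩ := hq
    exact two_ne_zero_of_odd_card (hcard ▸ hp.pow.pow)
  have h4 : (4 : F) ≠ 0 := by simpa [show (4 : F) = 2 * 2 by norm_num] using h2
  have hN : 1 + ζ ^ (q + 1) ≠ 0 := fun h => hN1 (by linear_combination h)
  unfold bgCurve
  simp only [eval_basePoly_upper hq0 h2 hβ0, gradBP_upper hq0 h2 hβ0]
  generalize ζ ^ (q + 1) = N at *
  ext z
  refine exists_congr fun x => exists_congr fun y => and_congr_right fun _ =>
    and_congr_right fun _ => and_congr_right fun _ => ⟨?_, fun h => ?_⟩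
  · rintro ⟨p, -, c, hc, hF, hgrad⟩
    have hx := congrFun hgrad 0
    have hy := congrFun hgrad 1
    have ht := congrFun hgrad 2
    simp only [Pi.smul_apply, smul_eq_mul, cons_val_zero, cons_val_one, cons_val, mul_one]
      at hx hy ht
    have ht' : p 2 = (c - p 0) / 2 := by field_simp; linear_combination ht
    have hp0 : p 0 = -(2 * c * (x - 2⁻¹)) / (1 + N) := by
      rw [ht'] at hx
      field_simp at hx ⊢
      linear_combination -hx
    have hp1 : p 1 = 2 * β ^ 2 * c * y / N := by
      field_simp at hy ⊢
      linear_combination hy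
    have key : c ^ 2 * (4⁻¹ - ((x - 2⁻¹) ^ 2 / (1 + N) - β ^ 2 * y ^ 2 / N)) = 0 := by
      rw [← hF, ht', hp0, hp1]
      field_simp
      ring
    have := (mul_eq_zero.mp key).resolve_left (pow_ne_zero 2 hc)
    linear_combination -this
  · refine ⟨![-(2 * (x - 2⁻¹)) / (1 + N), 2 * β ^ 2 * y / N,
      (1 + 2 * (x - 2⁻¹) / (1 + N)) / 2], fun h0 => ?_, 1, one_ne_zero, ?_, ?_⟩
    · have hx := congrFun h0 0
      have ht := congrFun h0 2
      simp only [cons_val_zero, cons_val, Pi.zero_apply] at hx ht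
      field_simp at hx ht
      exact hN (by linear_combination ht + hx)
    · simp only [cons_val_zero, cons_val_one, cons_val]
      rw [← sub_eq_zero] at h
      rw [← neg_eq_zero, ← h]
      field_simp
      ring
    · funext i
      fin_cases i <;> simp <;> field_simp <;> ring
end

section
/- Let q be an odd prime power, F the finite field with q² elements, ζ ∈ F, and A = [[1, ζ],[0, 0]]. Set N := ζ^{q+1} ∈ 𝔽_q and assume N ≠ 0 and N ≠ −1. Then the numerical range of A is the union of the scalings of the boundary generating conic: W(A) = { x + β·y : x, y ∈ 𝔽_q and there exists t ∈ 𝔽_q with (x − 2⁻¹)²/(1 + N) − α·y²/N = (1 − t²·(N + 1)/N)/4 }. -/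
open Matrix MvPolynomial

/-- The norm map `x ↦ x ^ (q + 1)` of a finite field with `q ^ 2` elements is onto the subfield
fixed by `x ↦ x ^ q`. -/
lemma exists_pow_succ_eq_of_pow_eq_self {F : Type*} [Field F] [Fintype F] {q : ℕ} (hq : 1 < q)
    (hcard : Fintype.card F = q ^ 2) {c : F} (hc : c ^ q = c) : ∃ a : F, a ^ (q + 1) = c := by
  classical
  rcases eq_or_ne c 0 with rfl | hc0
  · exact ⟨0, by simp⟩
  obtain ⟨g, hg⟩ := IsCyclic.exists_generator (α := Fˣ)
  obtain ⟨k, hk⟩ := (mem_powers_iff_mem_zpowers).2 (hg (Units.mk0 c hc0))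
  obtain ⟨m, rfl⟩ : ∃ m, q = m + 1 := ⟨q - 1, by omega⟩
  have hk' : g ^ k = Units.mk0 c hc0 := hk
  have hu : (Units.mk0 c hc0) ^ m = 1 := by
    ext
    apply mul_right_cancel₀ hc0
    simpa [← pow_succ] using hc
  rw [← hk', ← pow_mul] at hu
  have hord : orderOf g = (m + 1 + 1) * m := by
    rw [orderOf_eq_card_of_forall_mem_zpowers hg, Nat.card_eq_fintype_card, Fintype.card_units,
      hcard, Nat.sub_eq_of_eq_add]
    ring
  have hd := orderOf_dvd_of_pow_eq_one hu
  rw [hord] at hd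
  obtain ⟨j, rfl⟩ := Nat.dvd_of_mul_dvd_mul_right (by omega) hd
  refine ⟨((g ^ j : Fˣ) : F), ?_⟩
  have := congrArg (Units.val) hk'
  rw [mul_comm, pow_mul] at this
  simpa using this

/-- The numerical range of `!![1, ζ; 0, 0]` in terms of the coordinates of a unit vector. -/
lemma mem_numRange_one_zero {F : Type*} [Field F] {q : ℕ} {ζ z : F} :
    z ∈ numRange q (!![1, ζ; 0, 0]) ↔
      ∃ a b : F, a ^ q * a + b ^ q * b = 1 ∧ a ^ q * (a + ζ * b) = z := by
  constructor
  · rintro ⟨v, h1, h2⟩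
    exact ⟨v 0, v 1, by simpa [herm] using h1,
      by simpa [herm, Matrix.mulVec, dotProduct] using h2⟩
  · rintro ⟨a, b, h1, h2⟩
    exact ⟨![a, b], by simpa [herm] using h1,
      by simpa [herm, Matrix.mulVec, dotProduct] using h2⟩

theorem stmt_5 {F : Type*} [Field F] [Fintype F] (q : ℕ)
    (hq : ∃ p k : ℕ, p.Prime ∧ Odd p ∧ 0 < k ∧ q = p ^ k)
    (hcard : Fintype.card F = q ^ 2)
    (β : F) (hβ0 : β ≠ 0) (hβ : β ^ q = -β)
    (ζ : F) (hN0 : ζ ^ (q + 1) ≠ 0) (hN1 : ζ ^ (q + 1) ≠ -1) :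
    numRange q (!![1, ζ; 0, 0]) =
      {z : F | ∃ x y : F, x ^ q = x ∧ y ^ q = y ∧ z = x + β * y ∧
        ∃ t : F, t ^ q = t ∧
          (x - 2⁻¹) ^ 2 / (1 + ζ ^ (q + 1)) - β ^ 2 * y ^ 2 / ζ ^ (q + 1) =
            (1 - t ^ 2 * (ζ ^ (q + 1) + 1) / ζ ^ (q + 1)) / 4} := by
  obtain ⟨p, k, hp, hodd, hk, hqp⟩ := hq
  have : Fact p.Prime := ⟨hp⟩
  have : CharP F p := charP_of_card_eq_prime_pow (f := k * 2) (by rw [hcard, hqp, pow_mul])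
  have hq1 : 1 < q := hqp ▸ Nat.one_lt_pow hk.ne' hp.one_lt
  have h2 : (2 : F) ≠ 0 := by
    apply Ring.two_ne_zero
    rw [ringChar.eq F p]
    rintro rfl
    exact absurd hodd (by decide)
  have h4 : (4 : F) ≠ 0 := by
    rw [show (4 : F) = 2 * 2 by norm_num]; exact mul_ne_zero h2 h2
  obtain ⟨σ, hσ⟩ : ∃ σ : F →+* F, ∀ x, x ^ q = σ x :=
    ⟨iterateFrobenius F p k, fun x => by rw [iterateFrobenius_def, hqp]⟩
  have hσ2 : σ 2 = 2 := map_ofNat σ 2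
  have hσσ (x : F) : σ (σ x) = x := by
    rw [← hσ, ← hσ, ← pow_mul, ← sq, ← hcard, FiniteField.pow_card]
  have hsurj (c : F) (hc : σ c = c) : ∃ a : F, σ a * a = c := by
    obtain ⟨a, ha⟩ := exists_pow_succ_eq_of_pow_eq_self hq1 hcard (by rw [hσ, hc])
    exact ⟨a, by rw [← hσ, ← pow_succ, ha]⟩
  have hN : ζ ^ (q + 1) = σ ζ * ζ := by rw [pow_succ, hσ]
  rw [hN] at hN0 hN1 ⊢
  obtain ⟨N, hNdef⟩ : ∃ N, N = σ ζ * ζ := ⟨_, rfl⟩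
  have hσN : σ N = N := by rw [hNdef, map_mul, hσσ, mul_comm]
  rw [← hNdef] at hN0 hN1 ⊢
  have hN1' : 1 + N ≠ 0 := fun h => hN1 (by linear_combination h)
  have hζ0 : ζ ≠ 0 := by rintro rfl; simp at hNdef; exact hN0 hNdef
  rw [hσ] at hβ
  have conic (x y c t : F) (ht : 2 * (1 + N) * c = (1 + N) * t + (2 * x + N)) :
      (x - 2⁻¹) ^ 2 / (1 + N) - β ^ 2 * y ^ 2 / N = (1 - t ^ 2 * (N + 1) / N) / 4 ↔
        (x - c) ^ 2 - β ^ 2 * y ^ 2 = N * (c * (1 - c)) := by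
    have hc : c = (t + (2 * x + N) / (1 + N)) / 2 := by
      field_simp
      linear_combination ht
    have key : 4 * (1 + N) * ((x - c) ^ 2 - β ^ 2 * y ^ 2 - N * (c * (1 - c))) =
        4 * N * (1 + N) * ((x - 2⁻¹) ^ 2 / (1 + N) - β ^ 2 * y ^ 2 / N -
          (1 - t ^ 2 * (N + 1) / N) / 4) := by
      subst hc
      field_simp
      ring
    rw [← sub_eq_zero, ← sub_eq_zero (b := N * (c * (1 - c)))]
    constructor <;> intro h <;> rw [h] at key
    · simpa [h4, hN1'] using key
    · simpa [h4, hN1', hN0] using key.symm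
  ext z
  simp only [mem_numRange_one_zero, Set.mem_ofPred_eq, hσ]
  constructor
  · rintro ⟨a, b, hab, rfl⟩
    obtain ⟨c, hc⟩ : ∃ c, c = σ a * a := ⟨_, rfl⟩
    obtain ⟨w, hw⟩ : ∃ w, w = σ a * (ζ * b) := ⟨_, rfl⟩
    have hσc : σ c = c := by rw [hc, map_mul, hσσ, mul_comm]
    have hww : σ w * w = N * (c * (1 - c)) := by
      rw [hw, hc, ← hab, hNdef]; simp only [map_mul, hσσ]; ring
    refine ⟨c + (w + σ w) / 2, (w - σ w) / (2 * β), ?_, ?_, ?_,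
      2 * c - (2 * (c + (w + σ w) / 2) + N) / (1 + N), ?_, ?_⟩
    · simp [hσσ, hσc, hσ2, add_comm]
    · simp only [map_div₀, map_sub, map_mul, map_ofNat, hσσ, hβ]
      field_simp
      ring
    · rw [mul_add, ← hc, ← hw]
      field_simp
      ring
    · simp [hσσ, hσc, hσN, hσ2, add_comm]
    · rw [conic _ _ c _ (by field_simp; ring), ← hww]
      field_simp
      ring
  · rintro ⟨x, y, hx, hy, rfl, t, ht, h⟩
    obtain ⟨c, hc⟩ : ∃ c, c = (t + (2 * x + N) / (1 + N)) / 2 := ⟨_, rfl⟩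
    have hσc : σ c = c := by
      rw [hc]; simp only [map_div₀, map_add, map_mul, map_one, map_ofNat, hx, ht, hσN]
    rw [conic x y c t (by rw [hc]; field_simp)] at h
    obtain ⟨w, hw⟩ : ∃ w, w = x - c + β * y := ⟨_, rfl⟩
    have hσw : σ w = x - c - β * y := by
      rw [hw]; simp only [map_add, map_sub, map_mul, hx, hy, hσc, hβ]; ring
    have hww : σ w * w = N * (c * (1 - c)) := by
      rw [hσw, hw, ← h]; ring
    obtain ⟨a, ha⟩ := hsurj c hσc
    rcases eq_or_ne a 0 with rfl | ha0
    · obtain ⟨b, hb⟩ := hsurj 1 (map_one σ)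
      have hc0 : c = 0 := by simpa using ha.symm
      have hw0 : w = 0 := by simpa [hc0] using hww
      exact ⟨0, b, by simp [hb], by simp; linear_combination hw - hw0 - hc0⟩
    · have hσa : σ a ≠ 0 := by simpa using ha0
      have hσζ : σ ζ ≠ 0 := by simpa using hζ0
      refine ⟨a, w / (ζ * σ a), ?_, ?_⟩
      · simp only [map_div₀, map_mul, hσσ]
        rw [div_mul_div_comm, hww, hNdef, ← ha]
        field_simp
        ring
      · field_simp
        linear_combination ha + hw
end

section
/- Let q be an odd prime power, F the finite field with q² elements, and A = [[0, 1],[0, 0]]. Then for every z ∈ W(A): if z^{q+1} = 4⁻¹ then |S_z| = q + 1, and otherwise |S_z| = 2q + 2. -/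
open Matrix MvPolynomial

section NormOne

variable {F : Type*} [Field F]

/-- The orbit of `v` under scalars `u` with `u ^ q * u = 1`. -/
def unitOrbit (q : ℕ) (v : Fin 2 → F) : Set (Fin 2 → F) :=
  (fun u : F => u • v) '' {u | u ^ (q + 1) = 1}

theorem mem_preim_shift_iff (q : ℕ) (z : F) (v : Fin 2 → F) :
    v ∈ preim q (!![(0 : F), 1; 0, 0]) z ↔
      v 0 ^ q * v 0 + v 1 ^ q * v 1 = 1 ∧ v 0 ^ q * v 1 = z := by
  simp [preim, herm, Fin.sum_univ_two, Matrix.mulVec, dotProduct]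

theorem ncard_pow_succ_eq_one [Fintype F] {q : ℕ} (hcard : Fintype.card F = q ^ 2) :
    {u : F | u ^ (q + 1) = 1}.ncard = q + 1 := by
  classical
  obtain ⟨g, hg⟩ := IsCyclic.exists_ofOrder_eq_natCard (α := Fˣ)
  have hN : Nat.card Fˣ = (q - 1) * (q + 1) := by
    rw [Nat.card_eq_fintype_card, Fintype.card_units, hcard, mul_comm, ← Nat.sq_sub_sq, one_pow]
  have hg' : IsPrimitiveRoot (g : F) (Nat.card Fˣ) :=
    IsPrimitiveRoot.coe_units_iff.mpr (hg ▸ IsPrimitiveRoot.orderOf g)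
  have h := hg'.pow Nat.card_pos hN
  have hset : {u : F | u ^ (q + 1) = 1} =
      (Polynomial.nthRootsFinset (q + 1) (1 : F) : Set F) := by
    ext u
    simp
  rw [hset, Set.ncard_coe_finset, h.card_nthRootsFinset]

theorem ncard_unitOrbit [Fintype F] {q : ℕ} (hcard : Fintype.card F = q ^ 2) {v : Fin 2 → F} (hv : v ≠ 0) :
    (unitOrbit q v).ncard = q + 1 := by
  rw [unitOrbit, Set.ncard_image_of_injective _ (smul_left_injective F hv),
    ncard_pow_succ_eq_one hcard]

theorem mem_unitOrbit {q : ℕ} {v w : Fin 2 → F} (hv : v ≠ 0)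
    (h0 : v 0 ^ q * v 0 = w 0 ^ q * w 0) (h1 : v 1 ^ q * v 1 = w 1 ^ q * w 1)
    (h : v 0 ^ q * v 1 = w 0 ^ q * w 1) : w ∈ unitOrbit q v := by
  by_cases ha : v 0 = 0
  · have hb : v 1 ≠ 0 := fun hb => hv (by ext i; fin_cases i <;> simp [ha, hb])
    have hc : w 0 = 0 := by
      rw [ha, mul_zero, ← pow_succ] at h0
      exact eq_zero_of_pow_eq_zero h0.symm
    refine ⟨w 1 / v 1, ?_, ?_⟩
    · have : v 1 ^ (q + 1) ≠ 0 := pow_ne_zero _ hb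
      simp only [Set.mem_ofPred_eq, div_pow]
      rw [div_eq_one_iff_eq this, pow_succ, pow_succ, h1]
    · ext i; fin_cases i <;> simp [ha, hc, hb]
  · have hn : w 0 ^ (q + 1) = v 0 ^ (q + 1) := by rw [pow_succ, pow_succ, h0]
    have hne : w 0 ^ q ≠ 0 := by
      intro h'
      rw [h', zero_mul] at h0
      exact mul_ne_zero (pow_ne_zero _ ha) ha h0
    refine ⟨w 0 / v 0, ?_, ?_⟩
    · simp only [Set.mem_ofPred_eq, div_pow]
      rw [div_eq_one_iff_eq (pow_ne_zero _ ha), hn]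
    · ext i
      fin_cases i
      · simp [ha]
      · have : w 0 * v 1 = w 1 * v 0 := by
          apply mul_left_cancel₀ hne
          linear_combination (-v 1) * h0 + v 0 * h
        simp only [Fin.mk_one, Pi.smul_apply, smul_eq_mul]
        field_simp
        linear_combination this

theorem unitOrbit_subset_preim_shift {q : ℕ} {z : F} {v : Fin 2 → F}
    (hv : v ∈ preim q (!![(0 : F), 1; 0, 0]) z) :
    unitOrbit q v ⊆ preim q (!![(0 : F), 1; 0, 0]) z := by
  rintro _ ⟨u, hu, rfl⟩
  rw [mem_preim_shift_iff q] at hv ⊢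
  obtain ⟨h1, h2⟩ := hv
  have hu' : u ^ q * u = 1 := by rw [← pow_succ]; exact hu
  simp only [Pi.smul_apply, smul_eq_mul, mul_pow]
  constructor
  · linear_combination h1 + hu' * (v 0 ^ q * v 0 + v 1 ^ q * v 1)
  · linear_combination h2 + hu' * (v 0 ^ q * v 1)

/-- The involution `(a, b) ↦ (b ^ q, a ^ q)`. -/
def conjSwap (q : ℕ) (v : Fin 2 → F) : Fin 2 → F := ![v 1 ^ q, v 0 ^ q]

theorem conjSwap_ne_zero {q : ℕ} (hq : q ≠ 0) {v : Fin 2 → F} (hv : v ≠ 0) :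
    conjSwap q v ≠ 0 := by
  intro h
  apply hv
  have ha := congrFun h 1
  have hb := congrFun h 0
  simp only [conjSwap, Matrix.cons_val_zero, Matrix.cons_val_one, Pi.zero_apply,
    pow_eq_zero_iff hq] at ha hb
  ext i
  fin_cases i <;> simp [ha, hb]

theorem norm_eq_of_mem_unitOrbit {q : ℕ} {v w : Fin 2 → F} (h : w ∈ unitOrbit q v)
    (i : Fin 2) : w i ^ q * w i = v i ^ q * v i := by
  obtain ⟨u, hu, rfl⟩ := h
  have hu' : u ^ q * u = 1 := by rw [← pow_succ]; exact hu
  simp only [Pi.smul_apply, smul_eq_mul, mul_pow]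
  linear_combination v i ^ q * v i * hu'

theorem preim_shift_eq_union [Fintype F] {q : ℕ} (hq : q ≠ 0)
    (hcard : Fintype.card F = q ^ 2) {z : F} {v : Fin 2 → F}
    (hv : v ∈ preim q (!![(0 : F), 1; 0, 0]) z) :
    preim q (!![(0 : F), 1; 0, 0]) z = unitOrbit q v ∪ unitOrbit q (conjSwap q v) := by
  have hfrob (x : F) : (x ^ q) ^ q = x := by
    rw [← pow_mul, ← sq, ← hcard, FiniteField.pow_card]
  obtain ⟨h1, h2⟩ := (mem_preim_shift_iff q z v).mp hv
  have hv0 : v ≠ 0 := by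
    rintro rfl
    simp [hq] at h1
  have hs0 := conjSwap_ne_zero hq hv0
  have hs : conjSwap q v ∈ preim q (!![(0 : F), 1; 0, 0]) z := by
    rw [mem_preim_shift_iff q]
    simp only [conjSwap, Matrix.cons_val_zero, Matrix.cons_val_one, hfrob]
    constructor
    · linear_combination h1
    · linear_combination h2
  refine Set.Subset.antisymm (fun w hw => ?_)
    (Set.union_subset (unitOrbit_subset_preim_shift hv) (unitOrbit_subset_preim_shift hs))
  obtain ⟨k1, k2⟩ := (mem_preim_shift_iff q z w).mp hw
  have e := h2.trans k2.symm
  have e' : v 0 * v 1 ^ q = w 0 * w 1 ^ q := by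
    simpa only [mul_pow, hfrob] using congrArg (· ^ q) e
  have hprod : (v 0 ^ q * v 0 - w 0 ^ q * w 0) * (v 1 ^ q * v 1 - w 0 ^ q * w 0) = 0 := by
    linear_combination e * (v 0 * v 1 ^ q) + w 0 ^ q * w 1 * e'
      - (w 0 ^ q * w 0) * (h1 - k1)
  rcases mul_eq_zero.mp hprod with h | h
  · left
    exact mem_unitOrbit hv0 (by linear_combination h) (by linear_combination h1 - k1 - h) e
  · right
    refine mem_unitOrbit hs0 ?_ ?_ ?_ <;>
      simp only [conjSwap, Matrix.cons_val_zero, Matrix.cons_val_one, hfrob]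
    · linear_combination h
    · linear_combination h1 - k1 - h
    · linear_combination e

end NormOne

theorem stmt_6 {F : Type*} [Field F] [Fintype F] (q : ℕ)
    (hq : ∃ p k : ℕ, p.Prime ∧ Odd p ∧ 0 < k ∧ q = p ^ k)
    (hcard : Fintype.card F = q ^ 2)
    (β : F) (hβ0 : β ≠ 0) (hβ : β ^ q = -β) :
    ∀ z ∈ numRange q (!![(0 : F), 1; 0, 0]),
      (z ^ (q + 1) = 4⁻¹ → (preim q (!![(0 : F), 1; 0, 0]) z).ncard = q + 1) ∧
      (z ^ (q + 1) ≠ 4⁻¹ → (preim q (!![(0 : F), 1; 0, 0]) z).ncard = 2 * q + 2) := by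
  rintro z ⟨v, hv⟩
  replace hv : v ∈ preim q (!![(0 : F), 1; 0, 0]) z := hv
  obtain ⟨hodd, hq1⟩ : Odd q ∧ 1 < q := by
    obtain ⟨p, k, hp, hpo, hk, rfl⟩ := hq
    exact ⟨hpo.pow, Nat.one_lt_pow hk.ne' hp.one_lt⟩
  have hq0 : q ≠ 0 := by lia
  have h2 : (2 : F) ≠ 0 := by
    refine Ring.two_ne_zero fun h => ?_
    have := FiniteField.even_card_of_char_two h
    rw [hcard] at this
    have := Nat.odd_iff.mp (hodd.pow (n := 2))
    lia
  have h4 : (4 : F) ≠ 0 := by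
    rw [show (4 : F) = 2 * 2 by norm_num]
    exact mul_ne_zero h2 h2
  have hfrob (x : F) : (x ^ q) ^ q = x := by
    rw [← pow_mul, ← sq, ← hcard, FiniteField.pow_card]
  obtain ⟨h1, hz⟩ := (mem_preim_shift_iff q z v).mp hv
  have hnorm : z ^ (q + 1) = (v 0 ^ q * v 0) * (v 1 ^ q * v 1) := by
    rw [← hz, pow_succ, mul_pow, hfrob]
    ring
  have hdisc : (v 0 ^ q * v 0 - v 1 ^ q * v 1) ^ 2 = 1 - 4 * z ^ (q + 1) := by
    rw [hnorm]
    linear_combination (v 0 ^ q * v 0 + v 1 ^ q * v 1 + 1) * h1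
  have hv0 : v ≠ 0 := by
    rintro rfl
    simp [hq0] at h1
  have hs0 := conjSwap_ne_zero hq0 hv0
  rw [preim_shift_eq_union hq0 hcard hv]
  constructor
  · intro hz4
    have heq : v 0 ^ q * v 0 = v 1 ^ q * v 1 := by
      rw [hz4, mul_inv_cancel₀ h4, sub_self] at hdisc
      exact sub_eq_zero.mp (eq_zero_of_pow_eq_zero hdisc)
    have horb : unitOrbit q (conjSwap q v) ⊆ unitOrbit q v := by
      have hmem : conjSwap q v ∈ unitOrbit q v := by
        refine mem_unitOrbit hv0 ?_ ?_ ?_ <;>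
          simp only [conjSwap, Matrix.cons_val_zero, Matrix.cons_val_one, hfrob]
        · linear_combination heq
        · linear_combination -heq
        · ring
      obtain ⟨u, hu, hu'⟩ := hmem
      rintro _ ⟨t, ht, rfl⟩
      refine ⟨t * u, ?_, ?_⟩
      · simp only [Set.mem_ofPred_eq] at hu ht ⊢
        rw [mul_pow, hu, ht, one_mul]
      · simp only [← hu', mul_smul]
    rw [Set.union_eq_self_of_subset_right horb, ncard_unitOrbit hcard hv0]
  · intro hz4
    have hdisj : Disjoint (unitOrbit q v) (unitOrbit q (conjSwap q v)) := by
      refine Set.disjoint_left.mpr fun w hw hw' => hz4 ?_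
      have e := (norm_eq_of_mem_unitOrbit hw 0).symm.trans (norm_eq_of_mem_unitOrbit hw' 0)
      simp only [conjSwap, Matrix.cons_val_zero, hfrob] at e
      rw [e, mul_comm, sub_self] at hdisc
      refine eq_inv_of_mul_eq_one_right ?_
      linear_combination hdisc
    rw [Set.ncard_union_eq hdisj (Set.toFinite _) (Set.toFinite _),
      ncard_unitOrbit hcard hv0, ncard_unitOrbit hcard hs0]
    ring
end

section
/- Let q be an odd prime power, F the finite field with q² elements, and A = [[0, 1],[0, 0]]. Then the boundary generating curve of A is the circle Γ_A^∧ = { x + β·y : x, y ∈ 𝔽_q and x² − α·y² = 4⁻¹ }, equivalently Γ_A^∧ = { z ∈ F : z^{q+1} = 4⁻¹ }. -/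
open Matrix MvPolynomial

/-- For an odd prime power `q`, a field with `q ^ 2` elements has `2 ≠ 0` and `x ↦ x ^ q` is
additive on it. -/
theorem two_ne_zero_and_add_pow_of_card_eq_sq {F : Type*} [Field F] [Fintype F] {q : ℕ}
    (hq : ∃ p k : ℕ, p.Prime ∧ Odd p ∧ 0 < k ∧ q = p ^ k)
    (hcard : Fintype.card F = q ^ 2) :
    (2 : F) ≠ 0 ∧ ∀ x y : F, (x + y) ^ q = x ^ q + y ^ q := by
  obtain ⟨p, k, hp, hodd, hk, rfl⟩ := hq
  have : Fact p.Prime := ⟨hp⟩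
  obtain ⟨r, hr⟩ := CharP.exists F
  obtain ⟨n, hrp, hn⟩ := FiniteField.card F r
  have hrp' : r = p := by
    have h : r ∣ (p ^ k) ^ 2 := by
      rw [← hcard, hn]
      exact dvd_pow_self r n.ne_zero
    exact (Nat.prime_dvd_prime_iff_eq hrp hp).1 (hrp.dvd_of_dvd_pow (hrp.dvd_of_dvd_pow h))
  subst hrp'
  refine ⟨Ring.two_ne_zero ?_, fun x y => add_pow_char_pow x y r k⟩
  rw [ringChar.eq F r] at *
  rintro rfl
  exact absurd hodd (by decide)

/-- The base polynomial of the nilpotent `2 × 2` Jordan block. -/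
theorem basePoly_jordan {F : Type*} [Field F] {q : ℕ} (hq : q ≠ 0) (β : F) :
    basePoly q β !![(0 : F), 1; 0, 0] =
      X 2 * X 2 - (X 0 * C 2⁻¹ + X 1 * C (2 * β)⁻¹) * (X 0 * C 2⁻¹ - X 1 * C (2 * β)⁻¹) := by
  have h : ctrans q !![(0 : F), 1; 0, 0] = !![0, 0; 1, 0] := by
    ext i j
    fin_cases i <;> fin_cases j <;> simp [ctrans, hq]
  simp [basePoly, Hone, Htwo, h, Matrix.det_fin_two, -mul_eq_mul_left_iff]
  ring

/-- The gradient of the base polynomial of the nilpotent `2 × 2` Jordan block. -/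
theorem gradBP_jordan {F : Type*} [Field F] {q : ℕ} (hq : q ≠ 0) {β : F} (h2 : (2 : F) ≠ 0)
    (hβ : β ≠ 0) (p : Fin 3 → F) :
    gradBP q β !![(0 : F), 1; 0, 0] p = ![-(p 0 / 2), p 1 / (2 * β ^ 2), 2 * p 2] := by
  funext i
  fin_cases i <;>
    simp [gradBP, basePoly_jordan hq, pderiv_X] <;> field_simp <;> ring

/-- The boundary generating curve of the nilpotent `2 × 2` Jordan block is a circle. -/
theorem bgCurve_jordan {F : Type*} [Field F] {q : ℕ} (hq : q ≠ 0) {β : F} (h2 : (2 : F) ≠ 0)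
    (hβ : β ≠ 0) :
    bgCurve q β !![(0 : F), 1; 0, 0] =
      {z : F | ∃ x y : F, x ^ q = x ∧ y ^ q = y ∧ z = x + β * y ∧
        x ^ 2 - β ^ 2 * y ^ 2 = 4⁻¹} := by
  have h4 : (4 : F) ≠ 0 := by
    have h : (4 : F) = 2 * 2 := by norm_num
    rw [h]
    exact mul_ne_zero h2 h2
  ext z
  refine exists_congr fun x => exists_congr fun y => and_congr_right fun _ =>
    and_congr_right fun _ => and_congr_right fun _ => ?_
  simp only [gradBP_jordan hq h2 hβ, basePoly_jordan hq]
  constructor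
  · rintro ⟨p, -, c, hc, hF, hG⟩
    have e0 := congrFun hG 0
    have e1 := congrFun hG 1
    have e2 := congrFun hG 2
    simp at e0 e1 e2 hF
    have hx : p 0 = -(2 * c * x) := by
      field_simp at e0
      linear_combination -e0
    have hy : p 1 = 2 * β ^ 2 * c * y := by
      field_simp at e1
      linear_combination e1
    have ht : p 2 = c / 2 := by
      field_simp
      linear_combination e2
    rw [hx, hy, ht] at hF
    field_simp at hF ⊢
    refine mul_left_cancel₀ (pow_ne_zero 2 hc) ?_
    linear_combination -hF
  · intro h
    refine ⟨![-(2 * x), 2 * β ^ 2 * y, 2⁻¹], fun h0 => inv_ne_zero h2 (congrFun h0 2), 1,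
      one_ne_zero, ?_, ?_⟩
    · simp
      field_simp at h ⊢
      linear_combination -h
    · funext i
      fin_cases i <;> simp <;> field_simp

theorem stmt_7 {F : Type*} [Field F] [Fintype F] (q : ℕ)
    (hq : ∃ p k : ℕ, p.Prime ∧ Odd p ∧ 0 < k ∧ q = p ^ k)
    (hcard : Fintype.card F = q ^ 2)
    (β : F) (hβ0 : β ≠ 0) (hβ : β ^ q = -β) :
    bgCurve q β (!![(0 : F), 1; 0, 0]) =
      {z : F | ∃ x y : F, x ^ q = x ∧ y ^ q = y ∧ z = x + β * y ∧
        x ^ 2 - β ^ 2 * y ^ 2 = 4⁻¹} ∧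
    bgCurve q β (!![(0 : F), 1; 0, 0]) = {z : F | z ^ (q + 1) = 4⁻¹} := by
  obtain ⟨h2, hadd⟩ := two_ne_zero_and_add_pow_of_card_eq_sq hq hcard
  have hodd : Odd q := by
    obtain ⟨p, k, -, hp, -, rfl⟩ := hq
    exact hp.pow
  have hq0 : q ≠ 0 := hodd.pos.ne'
  have hconj : ∀ z : F, (z ^ q) ^ q = z := fun z => by
    rw [← pow_mul, ← sq, ← hcard, FiniteField.pow_card]
  have hsub : ∀ x y : F, (x - y) ^ q = x ^ q - y ^ q := fun x y => by
    rw [sub_eq_add_neg, hadd, hodd.neg_pow, sub_eq_add_neg]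
  have htwo : (2 : F) ^ q = 2 := by
    rw [← one_add_one_eq_two, hadd, one_pow]
  refine ⟨bgCurve_jordan hq0 h2 hβ0, ?_⟩
  rw [bgCurve_jordan hq0 h2 hβ0]
  ext z
  constructor
  · rintro ⟨x, y, hx, hy, rfl, h⟩
    change (x + β * y) ^ (q + 1) = 4⁻¹
    rw [pow_succ, hadd, mul_pow, hx, hy, hβ, ← h]
    ring
  · intro h
    change z ^ (q + 1) = 4⁻¹ at h
    rw [pow_succ] at h
    refine ⟨(z + z ^ q) / 2, (z - z ^ q) / (2 * β), ?_, ?_, ?_, ?_⟩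
    · rw [div_pow, hadd, hconj, htwo, add_comm]
    · rw [div_pow, hsub, hconj, mul_pow, htwo, hβ]
      field_simp
      ring
    · field_simp
      ring
    · rw [← h]
      field_simp
      ring
end

section
/- Let q be an odd prime power, F the finite field with q² elements, ζ ∈ F with ζ^{q+1} = −1, and A = [[1, ζ],[0, 0]]. Then for every nonzero ρ ∈ F, every eigenvector of the Hermitian part of ρA is isotropic: if v ∈ F² is nonzero and ((ρA + (ρA)*)/2)·v = λ·v for some λ ∈ F, then ⟨v,v⟩ = 0. -/
open Matrix MvPolynomial

theorem stmt_15 {F : Type*} [Field F] [Fintype F] (q : ℕ)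
    (hq : ∃ p k : ℕ, p.Prime ∧ Odd p ∧ 0 < k ∧ q = p ^ k)
    (hcard : Fintype.card F = q ^ 2)
    (β : F) (hβ0 : β ≠ 0) (hβ : β ^ q = -β)
    (ζ : F) (hζ : ζ ^ (q + 1) = -1) :
    ∀ ρ : F, ρ ≠ 0 → ∀ v : Fin 2 → F, v ≠ 0 → ∀ lam : F,
      (Hone q (ρ • (!![1, ζ; 0, 0] : Matrix (Fin 2) (Fin 2) F))).mulVec v = lam • v →
      herm q v v = 0 := by
  have hqodd : Odd q := by
    obtain ⟨p, k, -, hpodd, -, rfl⟩ := hq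
    exact hpodd.pow
  have hchar : (2 : F) ≠ 0 := by
    apply Ring.two_ne_zero
    intro h2
    have := FiniteField.even_card_of_char_two h2
    rw [hcard] at this
    have hodd : Odd (q ^ 2) := hqodd.pow
    rw [Nat.odd_iff] at hodd
    omega
  have hconj : ∀ x : F, (x ^ q) ^ q = x := fun x => by
    rw [← pow_mul, ← sq, ← hcard, FiniteField.pow_card]
  have hζ' : ζ ^ q * ζ = -1 := by rw [← pow_succ, hζ]
  have hζ0 : ζ ≠ 0 := by
    rintro rfl
    simp at hζ'
  intro ρ hρ v hv lam h
  have hR : ρ ^ q ≠ 0 := pow_ne_zero _ hρ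
  have h0 := congrFun h 0
  have h1 := congrFun h 1
  have hq0 : q ≠ 0 := hqodd.pos.ne'
  simp [Hone, ctrans, Matrix.mulVec, dotProduct, Fin.sum_univ_two, mul_pow, hq0, vecHead,
    vecTail] at h0 h1
  have e0 : (ρ + ρ ^ q) * v 0 + ρ * ζ * v 1 = 2 * lam * v 0 := by
    linear_combination 2 * h0 - (mul_inv_cancel₀ hchar) * ((ρ + ρ ^ q) * v 0 + ρ * ζ * v 1)
  have e1 : -(ρ ^ q * v 0) = 2 * lam * (ζ * v 1) := by
    linear_combination 2 * ζ * h1 - ρ ^ q * v 0 * hζ' -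
      (mul_inv_cancel₀ hchar) * (ρ ^ q * ζ ^ q * v 0 * ζ)
  have hx : v 0 ≠ 0 := by
    intro hx
    apply hv
    have hy : v 1 = 0 := by simpa [hx, hρ, hζ0] using e0
    ext i
    fin_cases i <;> simp [hx, hy]
  have key : (2 * lam - ρ) * (2 * lam - ρ ^ q) * v 0 = 0 := by
    linear_combination -(2 * lam) * e0 - ρ * e1
  simp only [herm, Fin.sum_univ_two]
  rcases mul_eq_zero.1 ((mul_eq_zero.1 key).resolve_right hx) with hL | hL
  · have e : ρ ^ q * v 0 = -(ρ * ζ * v 1) := by linear_combination -e1 - ζ * v 1 * hL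
    have e' : ρ * v 0 ^ q = -(ρ ^ q * ζ ^ q * v 1 ^ q) := by
      have := congrArg (· ^ q) e
      simpa only [mul_pow, hconj, hqodd.neg_pow] using this
    apply (mul_eq_zero.1 (?_ : (ρ * ρ ^ q) * _ = 0)).resolve_left (mul_ne_zero hρ hR)
    linear_combination ρ * v 0 ^ q * e - ρ * ζ * v 1 * e' +
      ρ * ρ ^ q * v 1 ^ q * v 1 * hζ'
  · have e : v 0 = -(ζ * v 1) := by
      apply mul_left_cancel₀ hR
      linear_combination -e1 - ζ * v 1 * hL
    have e' : v 0 ^ q = -(ζ ^ q * v 1 ^ q) := by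
      rw [e, hqodd.neg_pow, mul_pow]
    linear_combination v 0 ^ q * e - ζ * v 1 * e' + v 1 ^ q * v 1 * hζ'
end
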